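/- arXiv:2203.03090 — 4 statements merged into one kernel-verified Lean document; each statement's English description precedes it below -/
import Mathlib

section
/- Let R be a regular local ring with maximal ideal m, let u_1,...,u_k be part of a regular system of parameters generating an ideal I, and let w_1,...,w_k be nonnegative integers. Then the assignment ν(u_i) = w_i extends to a monomial valuation ν on R; in particular, if f and g are elements with ν(f) = a and ν(g) = b (defined as the largest value d with f in the ideal generated by monomials u^α with Σα_i w_i ≥ d), then ν(fg) = a + b. -/
/-- `u` is part of a regular system of parameters of the (regular) local ring `R`:
it extends to a family generating the maximal ideal whose cardinality is the
Krull dimension of `R`. -/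
def IsPartialRegSystemOfParams {R : Type*} [CommRing R] [IsLocalRing R] {k : ℕ}
    (u : Fin k → R) : Prop :=
  ∃ (n : ℕ) (v : Fin n → R) (e : Fin k ↪ Fin n),
    (∀ i, v (e i) = u i) ∧
    Ideal.span (Set.range v) = IsLocalRing.maximalIdeal R ∧
    ringKrullDim R = n

/-- The ideal `I_{ν,a}` generated by the monomials `u^α` with `∑ α i * w i ≥ a`. -/
def monomialIdeal {R : Type*} [CommRing R] {k : ℕ} (u : Fin k → R) (w : Fin k → ℕ)
    (a : ℕ) : Ideal R :=
  Ideal.span {x | ∃ α : Fin k → ℕ, a ≤ ∑ i, α i * w i ∧ x = ∏ i, u i ^ α i}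

open IsLocalRing RingTheory.Sequence

theorem ringKrullDim_le_length_of_ofList_eq_maximalIdeal {R : Type*} [CommRing R] [IsLocalRing R]
    [IsNoetherianRing R] (l : List R) (hl : Ideal.ofList l = maximalIdeal R) :
    ringKrullDim R ≤ l.length := by
  classical
  refine (ringKrullDim_le_spanFinrank_maximalIdeal R).trans ?_
  rw [← hl]
  have h := Submodule.spanFinrank_span_le_ncard_of_finite (R := R) (s := {r | r ∈ l})
    (List.finite_toSet l)
  have h' : Set.ncard {r | r ∈ l} ≤ l.length := by
    have : {r | r ∈ l} = (l.toFinset : Set R) := by ext; simp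
    rw [this, Set.ncard_coe_finset]
    exact l.toFinset_card_le
  exact_mod_cast h.trans h'

theorem ringKrullDim_le_quotient_ofList_add_length {R : Type*} [CommRing R] [IsLocalRing R]
    [IsNoetherianRing R] (l : List R) (hl : ∀ x ∈ l, x ∈ maximalIdeal R) :
    ringKrullDim R ≤ ringKrullDim (R ⧸ Ideal.ofList l) + l.length := by
  classical
  have hs : {r | r ∈ l} = (l.toFinset : Set R) := by ext; simp
  have h := ringKrullDim_le_ringKrullDim_quotient_add_card l.toFinset (fun x hx ↦ by
    rw [ringJacobson_eq_maximalIdeal]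
    exact hl x (by simpa using hx))
  rw [← hs] at h
  refine h.trans ?_
  gcongr
  exact_mod_cast l.toFinset_card_le

/-- Dividing by part of a regular system of parameters leaves a regular system of parameters. -/
theorem regularSystem_quotient {R : Type*} [CommRing R] [IsLocalRing R]
    [IsNoetherianRing R] (l₁ l₂ : List R) (hl : Ideal.ofList (l₁ ++ l₂) = maximalIdeal R)
    (hd : ringKrullDim R = (l₁ ++ l₂).length) :
    ∃ _ : IsLocalRing (R ⧸ Ideal.ofList l₁),
      Ideal.ofList (l₂.map (Ideal.Quotient.mk (Ideal.ofList l₁))) =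
        maximalIdeal (R ⧸ Ideal.ofList l₁) ∧
      ringKrullDim (R ⧸ Ideal.ofList l₁) =
        (l₂.map (Ideal.Quotient.mk (Ideal.ofList l₁))).length := by
  have hle : Ideal.ofList l₁ ≤ maximalIdeal R := by
    rw [← hl, Ideal.ofList_append]; exact le_sup_left
  have : Nontrivial (R ⧸ Ideal.ofList l₁) :=
    Ideal.Quotient.nontrivial_iff.mpr (ne_top_of_le_ne_top (maximalIdeal.isMaximal R).ne_top hle)
  have hloc := IsLocalRing.of_surjective' (Ideal.Quotient.mk (Ideal.ofList l₁))
    Ideal.Quotient.mk_surjective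
  have hmax : Ideal.ofList (l₂.map (Ideal.Quotient.mk (Ideal.ofList l₁))) =
      maximalIdeal (R ⧸ Ideal.ofList l₁) := by
    rw [← map_maximalIdeal_of_surjective _ (Ideal.Quotient.mk_surjective (I := Ideal.ofList l₁)),
      ← hl, Ideal.ofList_append, Ideal.map_sup, Ideal.map_quotient_self, bot_sup_eq,
      Ideal.map_ofList]
  refine ⟨hloc, hmax, le_antisymm (ringKrullDim_le_length_of_ofList_eq_maximalIdeal _ hmax) ?_⟩
  have h := ringKrullDim_le_quotient_ofList_add_length l₁
    (fun x hx ↦ hle (Ideal.subset_span hx))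
  rw [hd, List.length_append, add_comm, Nat.cast_add] at h
  rw [List.length_map]
  exact ENat.WithBot.add_le_add_natCast_right_iff.1 h

theorem exists_isPrime_ringKrullDim_le_quotient {R : Type*} [CommRing R] {n : ℕ}
    (hd : ringKrullDim R = n) :
    ∃ Q : Ideal R, Q.IsPrime ∧ (n : WithBot ℕ∞) ≤ ringKrullDim (R ⧸ Q) := by
  obtain ⟨p, hp⟩ := Order.le_krullDim_iff.mp (le_of_eq hd.symm)
  refine ⟨p.head.asIdeal, p.head.isPrime, ?_⟩
  have h : (PrimeSpectrum.zeroLocus (p.head.asIdeal : Set R)) = Set.Ici p.head := by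
    ext x
    simp [PrimeSpectrum.mem_zeroLocus, ← PrimeSpectrum.asIdeal_le_asIdeal]
  rw [ringKrullDim_quotient, h, ← Order.coheight_eq_krullDim_Ici, ← hp]
  exact_mod_cast Order.length_le_coheight_head (p := p)

/-- A Noetherian local ring is a domain if its maximal ideal is generated by `dim R` elements. -/
theorem isDomain_of_regularSystem {R : Type*} [CommRing R] [IsLocalRing R] [IsNoetherianRing R]
    (l : List R) (hl : Ideal.ofList l = maximalIdeal R) (hd : ringKrullDim R = l.length) :
    IsDomain R := by
  obtain ⟨n, hn⟩ : ∃ n, l.length = n := ⟨_, rfl⟩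
  induction n generalizing R with
  | zero =>
    rw [List.length_eq_zero_iff] at hn
    subst hn
    rw [Ideal.ofList_nil] at hl
    exact ((isField_iff_maximalIdeal_eq).2 hl.symm).isDomain
  | succ n ih =>
    match l, hn with
    | x :: l, hn =>
    have hn' : l.length = n := by simpa using hn
    obtain ⟨_, hmax, hdim⟩ := regularSystem_quotient [x] l hl hd
    have hdom := ih _ hmax hdim (by simpa using hn)
    rw [List.length_map, hn'] at hdim
    rw [Ideal.ofList_singleton] at hdim hdom
    have hxm : x ∈ maximalIdeal R := hl ▸ Ideal.subset_span List.mem_cons_self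
    obtain ⟨Q, hQ, hQd⟩ := exists_isPrime_ringKrullDim_le_quotient hd
    rw [hn] at hQd
    have hxQ : x ∉ Q := by
      intro h
      have h1 := ringKrullDim_le_of_surjective
        (Ideal.Quotient.factor ((Ideal.span_singleton_le_iff_mem Q).2 h))
        (Ideal.Quotient.factor_surjective _)
      rw [hdim] at h1
      have h2 := hQd.trans h1
      norm_cast at h2
      omega
    have hQx : Q ≤ Ideal.span {x} := by
      intro q hq
      by_contra hqx
      have h1 := ringKrullDim_quotient_succ_le_of_nonZeroDivisor
        (r := Ideal.Quotient.mk (Ideal.span {x}) q)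
        (mem_nonZeroDivisors_of_ne_zero fun h ↦ hqx (Ideal.Quotient.eq_zero_iff_mem.1 h))
      have : IsLocalRing (R ⧸ Q) := IsLocalRing.of_surjective' (Ideal.Quotient.mk Q)
        Ideal.Quotient.mk_surjective
      have h2 := ringKrullDim_le_quotient_ofList_add_length [Ideal.Quotient.mk Q x] (by
        simpa only [List.mem_singleton, forall_eq,
          ← map_maximalIdeal_of_surjective _ (Ideal.Quotient.mk_surjective (I := Q))]
          using Ideal.mem_map_of_mem _ hxm)
      rw [Ideal.ofList_singleton] at h2
      have h3 : ringKrullDim ((R ⧸ Q) ⧸ Ideal.span {Ideal.Quotient.mk Q x}) ≤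
          ringKrullDim
            ((R ⧸ Ideal.span {x}) ⧸ Ideal.span {Ideal.Quotient.mk (Ideal.span {x}) q}) := by
        have e1 := (DoubleQuot.quotQuotEquivQuotSup Q (Ideal.span {x})).ringKrullDim
        have e2 := (DoubleQuot.quotQuotEquivQuotSup (Ideal.span {x}) (Ideal.span {q})).ringKrullDim
        rw [Ideal.map_span, Set.image_singleton] at e1 e2
        rw [e1, e2]
        have hle : Ideal.span {x} ⊔ Ideal.span {q} ≤ Q ⊔ Ideal.span {x} :=
          sup_le le_sup_right (((Ideal.span_singleton_le_iff_mem Q).2 hq).trans le_sup_left)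
        exact ringKrullDim_le_of_surjective (Ideal.Quotient.factor hle)
          (Ideal.Quotient.factor_surjective _)
      have h4 : ((n + 1 : ℕ) : WithBot ℕ∞) ≤ n := by
        rw [hdim] at h1
        refine (hQd.trans h2).trans (le_trans ?_ h1)
        simpa using add_le_add_left h3 1
      norm_cast at h4
      omega
    have hQ0 : Q = ⊥ := by
      refine Submodule.eq_bot_of_le_smul_of_le_jacobson_bot (maximalIdeal R) Q
        (IsNoetherian.noetherian _) (fun q hq ↦ ?_) (maximalIdeal_le_jacobson _)
      obtain ⟨z, rfl⟩ := Ideal.mem_span_singleton'.1 (hQx hq)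
      rw [mul_comm]
      exact Submodule.smul_mem_smul hxm ((hQ.mem_or_mem hq).resolve_right hxQ)
    subst hQ0
    exact IsDomain.of_bot_isPrime R

theorem isPrime_ofList_of_regularSystem {R : Type*} [CommRing R] [IsLocalRing R]
    [IsNoetherianRing R] (l₁ l₂ : List R) (hl : Ideal.ofList (l₁ ++ l₂) = maximalIdeal R)
    (hd : ringKrullDim R = (l₁ ++ l₂).length) : (Ideal.ofList l₁).IsPrime := by
  obtain ⟨_, hmax, hdim⟩ := regularSystem_quotient l₁ l₂ hl hd
  exact (Ideal.Quotient.isDomain_iff_prime _).1 (isDomain_of_regularSystem _ hmax hdim)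

theorem isWeaklyRegular_of_regularSystem {R : Type*} [CommRing R] [IsLocalRing R]
    [IsNoetherianRing R] (l : List R) (hl : Ideal.ofList l = maximalIdeal R)
    (hd : ringKrullDim R = l.length) : IsWeaklyRegular R l := by
  refine ⟨fun i hi ↦ ?_⟩
  have hsplit : l = l.take i ++ l[i] :: l.drop (i + 1) := by simp
  have hP := isPrime_ofList_of_regularSystem (l.take i) (l[i] :: l.drop (i + 1))
    (hsplit ▸ hl) (hsplit ▸ hd)
  have hnot : l[i] ∉ Ideal.ofList (l.take i) := by
    intro hmem
    have h := ringKrullDim_le_length_of_ofList_eq_maximalIdeal (l.take i ++ l.drop (i + 1)) (by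
      rw [← hl]
      conv_rhs => rw [hsplit]
      rw [Ideal.ofList_append, Ideal.ofList_append, Ideal.ofList_cons, ← sup_assoc,
        sup_eq_left.2 ((Ideal.span_singleton_le_iff_mem _).2 hmem)])
    rw [hd] at h
    norm_cast at h
    simp at h
    omega
  rw [smul_eq_mul, Ideal.mul_top, isSMulRegular_iff_right_eq_zero_of_smul]
  intro y hy
  obtain ⟨y, rfl⟩ := Ideal.Quotient.mk_surjective y
  have hy' : l[i] * y ∈ Ideal.ofList (l.take i) := Ideal.Quotient.eq_zero_iff_mem.1 hy
  exact Ideal.Quotient.eq_zero_iff_mem.2 ((hP.mem_or_mem hy').resolve_left hnot)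

/-- The last element of a weakly regular sequence is regular modulo the preceding ones. -/
theorem mem_ofList_of_mul_mem_of_isWeaklyRegular {R : Type*} [CommRing R] {l : List R} {a y : R}
    (h : IsWeaklyRegular R (l ++ [a])) (hy : a * y ∈ Ideal.ofList l) : y ∈ Ideal.ofList l := by
  have h' := (isWeaklyRegular_singleton_iff _ _).1 ((isWeaklyRegular_append_iff _ _ _).1 h).2
  rw [smul_eq_mul, Ideal.mul_top, isSMulRegular_iff_right_eq_zero_of_smul] at h'
  exact Ideal.Quotient.eq_zero_iff_mem.1
    (h' (Ideal.Quotient.mk _ y) (Ideal.Quotient.eq_zero_iff_mem.2 hy))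

theorem isWeaklyRegular_map_pow_append {R ι : Type*} [CommRing R] [IsLocalRing R]
    [IsNoetherianRing R] (u : ι → R) (n : ι → ℕ) (hn : ∀ i, n i ≠ 0) (l : List ι) (s : List R)
    (hl : ∀ i ∈ l, u i ∈ maximalIdeal R) (hs : ∀ x ∈ s, x ∈ maximalIdeal R)
    (h : IsWeaklyRegular R (l.map u ++ s)) :
    IsWeaklyRegular R (l.map (fun i ↦ u i ^ n i) ++ s) := by
  induction l generalizing s with
  | nil => exact h
  | cons a l ih =>
    have ha : u a ∈ maximalIdeal R := hl a List.mem_cons_self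
    have hl' : ∀ i ∈ l, u i ∈ maximalIdeal R := fun i hi ↦ hl i (List.mem_cons_of_mem _ hi)
    have han : u a ^ n a ∈ maximalIdeal R := Ideal.pow_mem_of_mem _ ha _ (Nat.pos_of_ne_zero (hn a))
    have h1 : IsWeaklyRegular R ((l.map u ++ s) ++ [u a]) := by
      refine isWeaklyRegular_of_perm_of_subset_maximalIdeal h
        (List.perm_append_singleton _ _).symm ?_
      simp only [List.map_cons, List.cons_append, List.mem_cons, List.mem_append, List.mem_map]
      rintro r (rfl | ⟨i, hi, rfl⟩ | hr)
      exacts [ha, hl' i hi, hs r hr]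
    have h2 : IsWeaklyRegular R (l.map u ++ (s ++ [u a ^ n a])) := by
      rw [← List.append_assoc]
      rw [isWeaklyRegular_append_iff, isWeaklyRegular_singleton_iff] at h1 ⊢
      exact ⟨h1.1, h1.2.pow _⟩
    have hs' : ∀ x ∈ s ++ [u a ^ n a], x ∈ maximalIdeal R := by
      simp only [List.mem_append, List.mem_singleton]
      rintro r (hr | rfl)
      exacts [hs r hr, han]
    have h3 := ih (s ++ [u a ^ n a]) hl' hs' h2
    rw [← List.append_assoc] at h3
    refine isWeaklyRegular_of_perm_of_subset_maximalIdeal h3 (List.perm_append_singleton _ _) ?_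
    simp only [List.mem_append, List.mem_map, List.mem_singleton]
    rintro r ((⟨i, hi, rfl⟩ | hr) | rfl)
    exacts [Ideal.pow_mem_of_mem _ (hl' i hi) _ (Nat.pos_of_ne_zero (hn i)), hs r hr, han]

theorem mem_ofList_of_mul_prod_pow_mem {R ι : Type*} [CommRing R] [IsLocalRing R]
    [IsNoetherianRing R] (u : ι → R) (β : ι → ℕ) (c : R) (l : List ι) (s : List R)
    (hl : ∀ i ∈ l, u i ∈ maximalIdeal R) (hs : ∀ x ∈ s, x ∈ maximalIdeal R)
    (h : IsWeaklyRegular R (l.map u ++ s))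
    (hc : c * (l.map (fun i ↦ u i ^ β i)).prod ∈
      Ideal.ofList (l.map (fun i ↦ u i ^ (β i + 1)) ++ s)) :
    c ∈ Ideal.ofList (l.map u ++ s) := by
  induction l generalizing s with
  | nil => simpa using hc
  | cons a l ih =>
    have ha : u a ∈ maximalIdeal R := hl a List.mem_cons_self
    have hl' : ∀ i ∈ l, u i ∈ maximalIdeal R := fun i hi ↦ hl i (List.mem_cons_of_mem _ hi)
    have hsa : ∀ x ∈ s ++ [u a], x ∈ maximalIdeal R := by
      simp only [List.mem_append, List.mem_singleton]
      rintro r (hr | rfl)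
      exacts [hs r hr, ha]
    have h1 : IsWeaklyRegular R (l.map u ++ (s ++ [u a])) := by
      rw [← List.append_assoc]
      refine isWeaklyRegular_of_perm_of_subset_maximalIdeal h
        (List.perm_append_singleton _ _).symm ?_
      simp only [List.map_cons, List.cons_append, List.mem_cons, List.mem_append, List.mem_map]
      rintro r (rfl | ⟨i, hi, rfl⟩ | hr)
      exacts [ha, hl' i hi, hs r hr]
    have h2 := isWeaklyRegular_map_pow_append u (fun i ↦ β i + 1) (fun _ ↦ Nat.succ_ne_zero _)
      l _ hl' hsa h1
    rw [← List.append_assoc, isWeaklyRegular_append_iff, isWeaklyRegular_singleton_iff] at h2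
    have h3 : IsWeaklyRegular R ((l.map (fun i ↦ u i ^ (β i + 1)) ++ s) ++ [u a ^ β a]) := by
      rw [isWeaklyRegular_append_iff, isWeaklyRegular_singleton_iff]
      exact ⟨h2.1, h2.2.pow _⟩
    rw [List.map_cons, List.cons_append, Ideal.ofList_cons, Ideal.mem_span_singleton_sup] at hc
    obtain ⟨r, y, hy, hry⟩ := hc
    rw [List.map_cons, List.prod_cons] at hry
    have h4 := mem_ofList_of_mul_mem_of_isWeaklyRegular
      (y := c * (l.map (fun i ↦ u i ^ β i)).prod - r * u a) h3 (by
        convert hy using 1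
        linear_combination -hry)
    have h5 := ih (s ++ [u a]) hl' hsa h1 (by
      rw [← List.append_assoc, Ideal.ofList_append, Ideal.ofList_singleton]
      rw [← sub_add_cancel (c * (l.map (fun i ↦ u i ^ β i)).prod) (r * u a)]
      exact Submodule.add_mem_sup h4 (Ideal.mem_span_singleton'.2 ⟨r, rfl⟩))
    convert h5 using 1
    simp only [Ideal.ofList_append, List.map_cons, Ideal.ofList_cons, Ideal.ofList_nil, sup_bot_eq]
    ac_rfl

theorem prod_pow_mem_monomialIdeal {R : Type*} [CommRing R] {k : ℕ} (u : Fin k → R)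
    (w : Fin k → ℕ) {a : ℕ} (α : Fin k → ℕ) (h : a ≤ ∑ i, α i * w i) :
    ∏ i, u i ^ α i ∈ monomialIdeal u w a :=
  Ideal.subset_span ⟨α, h, rfl⟩

theorem monomialIdeal_mul_le {R : Type*} [CommRing R] {k : ℕ} (u : Fin k → R)
    (w : Fin k → ℕ) (a b : ℕ) :
    monomialIdeal u w a * monomialIdeal u w b ≤ monomialIdeal u w (a + b) := by
  rw [monomialIdeal, monomialIdeal, Ideal.span_mul_span', Ideal.span_le]
  rintro _ ⟨_, ⟨α, hα, rfl⟩, _, ⟨β, hβ, rfl⟩, rfl⟩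
  refine Ideal.subset_span ⟨α + β, ?_, ?_⟩
  · simpa [add_mul, Finset.sum_add_distrib] using add_le_add hα hβ
  · simp [pow_add, Finset.prod_mul_distrib]

/-- The exponents of weight `a` that involve only variables of positive weight. -/
def weightedExponents {k : ℕ} (w : Fin k → ℕ) (a : ℕ) : Set (Fin k →₀ ℕ) :=
  {α | ∑ i, α i * w i = a ∧ ∀ i, w i = 0 → α i = 0}

theorem mul_mem_restrictSupport_weightedExponents {R : Type*} [CommRing R] {k : ℕ}
    {w : Fin k → ℕ} {a b : ℕ} {F G : MvPolynomial (Fin k) R}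
    (hF : F ∈ MvPolynomial.restrictSupport R (weightedExponents w a))
    (hG : G ∈ MvPolynomial.restrictSupport R (weightedExponents w b)) :
    F * G ∈ MvPolynomial.restrictSupport R (weightedExponents w (a + b)) := by
  classical
  rw [MvPolynomial.mem_restrictSupport_iff] at *
  intro γ hγ
  obtain ⟨α, hα, β, hβ, rfl⟩ := Finset.mem_add.1 (MvPolynomial.support_mul F G hγ)
  obtain ⟨hα₁, hα₂⟩ := hF hα
  obtain ⟨hβ₁, hβ₂⟩ := hG hβ
  refine ⟨?_, fun i hi ↦ by simp [hα₂ i hi, hβ₂ i hi]⟩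
  simp [add_mul, Finset.sum_add_distrib, hα₁, hβ₁]

theorem exists_eval_sub_mem_monomialIdeal {R : Type*} [CommRing R] {k : ℕ} (u : Fin k → R)
    (w : Fin k → ℕ) {a : ℕ} {f : R} (hf : f ∈ monomialIdeal u w a) :
    ∃ F ∈ MvPolynomial.restrictSupport R (weightedExponents w a),
      f - MvPolynomial.eval u F ∈ monomialIdeal u w (a + 1) := by
  classical
  have hle : monomialIdeal u w a ≤
      (MvPolynomial.restrictSupport R (weightedExponents w a)).map
        (MvPolynomial.aeval u).toLinearMap ⊔ monomialIdeal u w (a + 1) := by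
    refine Submodule.span_le.2 ?_
    rintro _ ⟨α, hα, rfl⟩
    rcases hα.eq_or_lt with h | h
    · refine Submodule.mem_sup_left ⟨MvPolynomial.monomial
        (Finsupp.equivFunOnFinite.symm fun i ↦ if w i = 0 then 0 else α i)
        (∏ i, if w i = 0 then u i ^ α i else 1), ?_, ?_⟩
      · refine (MvPolynomial.monomial_mem_restrictSupport R).2 (Or.inl ⟨?_, fun i hi ↦ by simp [hi]⟩)
        rw [h]
        refine Finset.sum_congr rfl fun i _ ↦ ?_
        by_cases hi : w i = 0 <;> simp [hi]
      · rw [AlgHom.toLinearMap_apply, MvPolynomial.aeval_monomial, Algebra.algebraMap_self_apply,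
          Finsupp.prod_fintype _ _ (fun _ ↦ pow_zero _), ← Finset.prod_mul_distrib]
        refine Finset.prod_congr rfl fun i _ ↦ ?_
        by_cases hi : w i = 0 <;> simp [hi]
    · exact Submodule.mem_sup_right (prod_pow_mem_monomialIdeal u w α h)
  obtain ⟨_, ⟨F, hF, rfl⟩, y, hy, rfl⟩ := Submodule.mem_sup.1 (hle hf)
  refine ⟨F, hF, ?_⟩
  simpa [MvPolynomial.aeval_eq_eval] using hy

theorem eval_mem_monomialIdeal {R : Type*} [CommRing R] {k : ℕ} (u : Fin k → R)
    (w : Fin k → ℕ) {a : ℕ} {F : MvPolynomial (Fin k) R}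
    (hF : F ∈ MvPolynomial.restrictSupport R (weightedExponents w a)) :
    MvPolynomial.eval u F ∈ monomialIdeal u w a := by
  rw [MvPolynomial.eval_eq']
  exact Ideal.sum_mem _ fun α hα ↦ Ideal.mul_mem_left _ _
    (prod_pow_mem_monomialIdeal u w α (hF hα).1.ge)

theorem ofList_map_le_monomialIdeal_one {R : Type*} [CommRing R] {k : ℕ} (u : Fin k → R)
    (w : Fin k → ℕ) (S : List (Fin k)) (hS : ∀ i ∈ S, w i ≠ 0) :
    Ideal.ofList (S.map u) ≤ monomialIdeal u w 1 := by
  classical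
  rw [Ideal.span_le]
  intro x hx
  obtain ⟨i, hi, rfl⟩ := List.mem_map.1 hx
  refine Ideal.subset_span ⟨Pi.single i 1, ?_, ?_⟩
  · simpa [Pi.single_apply, Nat.one_le_iff_ne_zero] using hS i hi
  · simp [Pi.single_apply, pow_ite]

theorem eval_mem_monomialIdeal_succ {R : Type*} [CommRing R] {k : ℕ} (u : Fin k → R)
    (w : Fin k → ℕ) {a : ℕ} {J : Ideal R} (hJ : J ≤ monomialIdeal u w 1)
    {F : MvPolynomial (Fin k) R}
    (hF : F ∈ MvPolynomial.restrictSupport R (weightedExponents w a))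
    (hFJ : ∀ α, F.coeff α ∈ J) :
    MvPolynomial.eval u F ∈ monomialIdeal u w (a + 1) := by
  rw [MvPolynomial.eval_eq', add_comm]
  exact Ideal.sum_mem _ fun α hα ↦ monomialIdeal_mul_le u w 1 a
    (Ideal.mul_mem_mul (hJ (hFJ α)) (prod_pow_mem_monomialIdeal u w α (hF hα).1.ge))

/-- Weighted quasi-regularity of a weakly regular sequence in a Noetherian local ring. -/
theorem coeff_mem_of_eval_mem_monomialIdeal_succ {R : Type*} [CommRing R] [IsLocalRing R]
    [IsNoetherianRing R] {k : ℕ} (u : Fin k → R) (w : Fin k → ℕ) (S : List (Fin k))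
    (hnd : S.Nodup) (hS : ∀ i, i ∈ S ↔ w i ≠ 0) (hu : ∀ i ∈ S, u i ∈ maximalIdeal R)
    (hreg : IsWeaklyRegular R (S.map u)) {a : ℕ} {F : MvPolynomial (Fin k) R}
    (hF : F ∈ MvPolynomial.restrictSupport R (weightedExponents w a))
    (hFu : MvPolynomial.eval u F ∈ monomialIdeal u w (a + 1)) (β : Fin k →₀ ℕ) :
    F.coeff β ∈ Ideal.ofList (S.map u) := by
  classical
  by_cases hβ : β ∈ F.support
  swap
  · rw [MvPolynomial.notMem_support_iff.1 hβ]
    exact zero_mem _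
  set L := Ideal.ofList (S.map fun i ↦ u i ^ (β i + 1))
  have hmem : ∀ γ : Fin k → ℕ, (∃ i, w i ≠ 0 ∧ β i < γ i) → ∏ i, u i ^ γ i ∈ L := by
    rintro γ ⟨i, hi, hlt⟩
    refine Ideal.mem_of_dvd _ ((pow_dvd_pow (u i) hlt).trans
      (Finset.dvd_prod_of_mem (fun i ↦ u i ^ γ i) (Finset.mem_univ i)))
      (Ideal.subset_span (List.mem_map.2 ⟨i, (hS i).2 hi, rfl⟩))
  have hlt : ∀ γ : Fin k → ℕ, a < ∑ i, γ i * w i → ∃ i, w i ≠ 0 ∧ β i < γ i := by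
    intro γ hγ
    rw [← (hF hβ).1] at hγ
    obtain ⟨i, -, hi⟩ := Finset.exists_lt_of_sum_lt hγ
    exact ⟨i, fun h ↦ by simp [h] at hi, lt_of_mul_lt_mul_right hi (Nat.zero_le _)⟩
  have hsub : monomialIdeal u w (a + 1) ≤ L := by
    refine Ideal.span_le.2 ?_
    rintro _ ⟨γ, hγ, rfl⟩
    exact hmem γ (hlt γ hγ)
  have hother : ∀ γ ∈ F.support.erase β, F.coeff γ * ∏ i, u i ^ γ i ∈ L := by
    intro γ hγ
    obtain ⟨hne, hγF⟩ := Finset.mem_erase.1 hγ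
    refine Ideal.mul_mem_left _ _ (hmem γ ?_)
    by_contra! hle
    have hle' : ∀ i, γ i ≤ β i := fun i ↦ by
      by_cases hi : w i = 0
      · simp [(hF hγF).2 i hi]
      · exact hle i hi
    have hsum := (Finset.sum_eq_sum_iff_of_le
      (fun i (_ : i ∈ Finset.univ) ↦ Nat.mul_le_mul_right (w i) (hle' i))).1
      ((hF hγF).1.trans (hF hβ).1.symm)
    refine hne (Finsupp.ext fun i ↦ ?_)
    by_cases hi : w i = 0
    · rw [(hF hγF).2 i hi, (hF hβ).2 i hi]
    · exact Nat.eq_of_mul_eq_mul_right (Nat.pos_of_ne_zero hi) (hsum i (Finset.mem_univ i))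
  have hmain : F.coeff β * ∏ i, u i ^ β i ∈ L := by
    have h := hsub hFu
    rw [MvPolynomial.eval_eq', ← Finset.add_sum_erase _ _ hβ] at h
    exact (Ideal.add_mem_iff_left _ (Ideal.sum_mem _ hother)).1 h
  have hprod : ∏ i, u i ^ β i = (S.map fun i ↦ u i ^ β i).prod := by
    rw [← List.prod_toFinset _ hnd]
    refine (Finset.prod_subset (Finset.subset_univ _) fun i _ hi ↦ ?_).symm
    rw [List.mem_toFinset, hS, not_not] at hi
    rw [(hF hβ).2 i hi, pow_zero]
  have h := mem_ofList_of_mul_prod_pow_mem u β (F.coeff β) S [] hu (by simp)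
    (by simpa using hreg) (by rw [List.append_nil, ← hprod]; exact hmain)
  rwa [List.append_nil] at h

/-- Part of a regular system of parameters, indexed by any duplicate-free list, is a weakly regular
sequence generating a prime ideal. -/
theorem IsPartialRegSystemOfParams.isWeaklyRegular_and_isPrime {R : Type*} [CommRing R]
    [IsLocalRing R] [IsNoetherianRing R] {k : ℕ} {u : Fin k → R}
    (hu : IsPartialRegSystemOfParams u) (S : List (Fin k)) (hnd : S.Nodup) :
    (∀ i, u i ∈ maximalIdeal R) ∧ IsWeaklyRegular R (S.map u) ∧
      (Ideal.ofList (S.map u)).IsPrime := by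
  obtain ⟨n, v, e, hve, hv, hd⟩ := hu
  obtain ⟨S', hS', hsub⟩ := List.subperm_of_subset (hnd.map e.injective)
    (fun i _ ↦ List.mem_finRange i : S.map e ⊆ List.finRange n)
  obtain ⟨T, hT⟩ := hsub.exists_perm_append
  have hperm : List.Perm ((List.finRange n).map v) (S.map u ++ T.map v) := by
    have h := (hT.trans (hS'.append_right T)).map v
    rwa [List.map_append, List.map_map, show v ∘ e = u from funext hve] at h
  have hspan : Ideal.ofList (S.map u ++ T.map v) = maximalIdeal R := by
    rw [← hv, Ideal.ofList]
    congr 1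
    ext x
    rw [Set.mem_ofPred_eq, ← hperm.mem_iff]
    simp
  have hdim : ringKrullDim R = (S.map u ++ T.map v).length := by
    rw [hd, ← hperm.length_eq, List.length_map, List.length_finRange]
  refine ⟨fun i ↦ ?_, ((isWeaklyRegular_append_iff _ _ _).1
    (isWeaklyRegular_of_regularSystem _ hspan hdim)).1,
    isPrime_ofList_of_regularSystem _ _ hspan hdim⟩
  rw [← hv, ← hve i]
  exact Ideal.subset_span ⟨e i, rfl⟩

/-- Assigning the weights `ν (u i) = w i` to part of a regular system of
parameters of a regular local ring determines a *monomial valuation*: if `ν f = a` and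
`ν g = b` (i.e. `f ∈ I_{ν,a} \ I_{ν,a+1}` and `g ∈ I_{ν,b} \ I_{ν,b+1}`), then
`ν (f * g) = a + b`. -/
theorem monomial_valuation_additive
    {R : Type*} [CommRing R] [IsLocalRing R] [IsNoetherianRing R] {k : ℕ}
    (u : Fin k → R) (w : Fin k → ℕ)
    (hu : IsPartialRegSystemOfParams u)
    (f g : R) (a b : ℕ)
    (hfa : f ∈ monomialIdeal u w a) (hfa' : f ∉ monomialIdeal u w (a + 1))
    (hgb : g ∈ monomialIdeal u w b) (hgb' : g ∉ monomialIdeal u w (b + 1)) :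
    f * g ∈ monomialIdeal u w (a + b) ∧ f * g ∉ monomialIdeal u w (a + b + 1) := by
  refine ⟨monomialIdeal_mul_le u w a b (Ideal.mul_mem_mul hfa hgb), fun hfg ↦ ?_⟩
  set S := (List.finRange k).filter fun i ↦ w i ≠ 0 with hSdef
  have hS : ∀ i, i ∈ S ↔ w i ≠ 0 := fun i ↦ by simp [hSdef]
  have hnd : S.Nodup := (List.nodup_finRange k).filter _
  obtain ⟨hmax, hreg, hprime⟩ := hu.isWeaklyRegular_and_isPrime S hnd
  have hJ := ofList_map_le_monomialIdeal_one u w S fun i ↦ (hS i).1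
  set J := Ideal.ofList (S.map u)
  obtain ⟨F, hF, hfF⟩ := exists_eval_sub_mem_monomialIdeal u w hfa
  obtain ⟨G, hG, hgG⟩ := exists_eval_sub_mem_monomialIdeal u w hgb
  have hcoeff : ∀ H : MvPolynomial (Fin k) R,
      MvPolynomial.map (Ideal.Quotient.mk J) H = 0 ↔ ∀ α, H.coeff α ∈ J := fun H ↦ by
    simp [MvPolynomial.ext_iff, MvPolynomial.coeff_map, Ideal.Quotient.eq_zero_iff_mem]
  have hFG : MvPolynomial.eval u (F * G) ∈ monomialIdeal u w (a + b + 1) := by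
    have h1 := monomialIdeal_mul_le u w _ _ (Ideal.mul_mem_mul hfF hgb)
    have h2 := monomialIdeal_mul_le u w _ _ (Ideal.mul_mem_mul (eval_mem_monomialIdeal u w hF) hgG)
    rw [add_right_comm] at h1
    rw [← add_assoc] at h2
    convert sub_mem (sub_mem hfg h1) h2 using 1
    rw [map_mul]
    ring
  have hzero := (hcoeff _).2 (coeff_mem_of_eval_mem_monomialIdeal_succ u w S hnd hS
    (fun i _ ↦ hmax i) hreg (mul_mem_restrictSupport_weightedExponents hF hG) hFG)
  rw [map_mul, mul_eq_zero, hcoeff, hcoeff] at hzero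
  rcases hzero with h | h
  · exact hfa' ((Submodule.sub_mem_iff_left _ (eval_mem_monomialIdeal_succ u w hJ hF h)).1 hfF)
  · exact hgb' ((Submodule.sub_mem_iff_left _ (eval_mem_monomialIdeal_succ u w hJ hG h)).1 hgG)
end

section
/- Let R be a regular local ring, u_1,...,u_k part of a regular system of parameters, and w_1,...,w_k positive integers. Let ν be the monomial valuation with ν(u_i) = w_i. Then for any positive rational a, the ideal of sections of the Q-ideal (u_1^{1/w_1},...,u_k^{1/w_k})^a equals {f ∈ R : ν(f) ≥ a}, which is the ideal generated by monomials u_1^{c_1}···u_k^{c_k} with c_1 w_1 + ... + c_k w_k ≥ a. -/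
/-- `f` belongs to the integral closure of the ideal `J`: it satisfies an equation
of integral dependence `f^n + c₁ f^{n-1} + ⋯ + c_n = 0` with `c_i ∈ J^i`. -/
def MemIntegralClosureOfIdeal {R : Type*} [CommRing R] (J : Ideal R) (f : R) : Prop :=
  ∃ n : ℕ, 0 < n ∧ ∃ c : Fin n → R, (∀ i : Fin n, c i ∈ J ^ ((i : ℕ) + 1)) ∧
    f ^ n + ∑ i, c i * f ^ (n - 1 - (i : ℕ)) = 0

/-- The ideal generated by the monomials `u^c` with `∑ c i * w i ≥ a`, for a rational `a`. -/
def monomialIdealQ {R : Type*} [CommRing R] {k : ℕ} (u : Fin k → R) (w : Fin k → ℕ)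
    (a : ℚ) : Ideal R :=
  Ideal.span {x | ∃ c : Fin k → ℕ, a ≤ ∑ i, (c i : ℚ) * w i ∧ x = ∏ i, u i ^ c i}

open IsLocalRing in
/-- A family of `n` generators of the maximal ideal, where `n` is the dimension. -/
def IsRegSystemOfParams {R : Type*} [CommRing R] [IsLocalRing R] {n : ℕ} (v : Fin n → R) : Prop :=
  Ideal.span (Set.range v) = maximalIdeal R ∧ ringKrullDim R = n

section RegularLocal

open IsLocalRing

variable {R : Type*} [CommRing R] [IsLocalRing R]

theorem IsRegSystemOfParams.mem {n : ℕ} {v : Fin n → R} (hv : IsRegSystemOfParams v) (i : Fin n) :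
    v i ∈ maximalIdeal R :=
  hv.1 ▸ Ideal.subset_span ⟨i, rfl⟩

theorem maximalIdeal_ne_bot_of_ringKrullDim {n : ℕ} (h : ringKrullDim R = (n + 1 : ℕ)) :
    maximalIdeal R ≠ ⊥ := by
  intro h0
  have : IsField R := isField_iff_maximalIdeal_eq.mpr h0
  rw [ringKrullDim_eq_zero_of_isField this] at h
  norm_cast at h

theorem maximalIdeal_le_span_singleton_sup {n : ℕ} {v : Fin (n + 1) → R}
    (hv : IsRegSystemOfParams v) {x : R} (hx : x ∈ maximalIdeal R)
    (hx2 : x ∉ maximalIdeal R ^ 2) :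
    ∃ i : Fin (n + 1), maximalIdeal R ≤
      Ideal.span {x} ⊔ Ideal.span (Set.range fun j => v (i.succAbove j)) := by
  obtain ⟨r, rfl⟩ := (Ideal.mem_span_range_iff_exists_fun).mp (hv.1 ▸ hx)
  obtain ⟨i, hi⟩ : ∃ i, r i ∉ maximalIdeal R := by
    by_contra! h
    exact hx2 <| Ideal.sum_mem _ fun i _ => pow_two (maximalIdeal R) ▸
      Ideal.mul_mem_mul (h i) (hv.mem i)
  refine ⟨i, ?_⟩
  rw [← hv.1, Ideal.span_le, Set.range_subset_iff]
  have hj : ∀ j, v (i.succAbove j) ∈ Ideal.span {∑ i, r i * v i} ⊔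
      Ideal.span (Set.range fun j => v (i.succAbove j)) := fun j =>
    Ideal.mem_sup_right (Ideal.subset_span ⟨j, rfl⟩)
  intro k
  rcases Fin.eq_self_or_eq_succAbove i k with rfl | ⟨j, rfl⟩
  · have hu : IsUnit (r k) := by simpa using hi
    refine (Ideal.unit_mul_mem_iff_mem _ hu).mp ?_
    have h1 : ∑ i, r i * v i ∈ Ideal.span {∑ i, r i * v i} ⊔
      Ideal.span (Set.range fun j => v (k.succAbove j)) :=
        Ideal.mem_sup_left (Ideal.mem_span_singleton_self _)
    rw [Fin.sum_univ_succAbove _ k] at h1 ⊢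
    refine (Ideal.add_mem_iff_left _ ?_).mp h1
    rw [← Fin.sum_univ_succAbove (fun i => r i * v i)]
    exact Ideal.sum_mem _ fun j _ => Ideal.mul_mem_left _ _ (hj j)
  · exact hj j

instance isLocalRing_quotient_span_singleton_of_mem {x : R} [hx : Fact (x ∈ maximalIdeal R)] :
    IsLocalRing (R ⧸ Ideal.span {x}) := by
  have : Nontrivial (R ⧸ Ideal.span {x}) := Ideal.Quotient.nontrivial_iff.mpr fun h =>
    (maximalIdeal.isMaximal R).ne_top <| top_le_iff.mp <| h ▸
      (Ideal.span_singleton_le_iff_mem _).mpr hx.out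
  exact .of_surjective' (Ideal.Quotient.mk _) Ideal.Quotient.mk_surjective

variable [IsNoetherianRing R]

theorem ringKrullDim_le_of_span_range_eq_maximalIdeal {n : ℕ} {v : Fin n → R}
    (hv : Ideal.span (Set.range v) = maximalIdeal R) : ringKrullDim R ≤ n := by
  refine (ringKrullDim_le_spanFinrank_maximalIdeal R).trans ?_
  rw [← hv]
  have := (Submodule.spanFinrank_span_le_ncard_of_finite (R := R) (Set.finite_range v)).trans
    (Set.image_univ (f := v) ▸ Set.ncard_image_le Set.finite_univ)
  exact_mod_cast this.trans_eq (by simp [Set.ncard_univ])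

theorem IsRegSystemOfParams.quotient {n : ℕ} {x : R} [hx : Fact (x ∈ maximalIdeal R)]
    {t : Fin n → R} (ht : maximalIdeal R ≤ Ideal.span {x} ⊔ Ideal.span (Set.range t))
    (ht' : ∀ i, t i ∈ maximalIdeal R) (hdim : ringKrullDim R = (n + 1 : ℕ)) :
    IsRegSystemOfParams (fun i => Ideal.Quotient.mk (Ideal.span {x}) (t i)) := by
  have hspan : Ideal.span (Set.range fun i => Ideal.Quotient.mk (Ideal.span {x}) (t i)) =
      maximalIdeal (R ⧸ Ideal.span {x}) := by
    rw [← map_maximalIdeal_of_surjective (Ideal.Quotient.mk (Ideal.span {x}))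
      Ideal.Quotient.mk_surjective]
    rw [← Function.comp_def, Set.range_comp, ← Ideal.map_span]
    apply le_antisymm
    · exact Ideal.map_mono (Ideal.span_le.mpr (Set.range_subset_iff.mpr ht'))
    · refine (Ideal.map_mono ht).trans ?_
      rw [Ideal.map_sup, Ideal.map_quotient_self, bot_sup_eq]
  refine ⟨hspan, le_antisymm (ringKrullDim_le_of_span_range_eq_maximalIdeal hspan) ?_⟩
  have h := Ideal.height_le_ringKrullDim_quotient_add_one hx.out
  rw [maximalIdeal_height_eq_ringKrullDim, hdim] at h
  have : ((n + 1 : ℕ) : WithBot ℕ∞) = (n : WithBot ℕ∞) + 1 := by norm_cast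
  rw [this] at h
  exact ENat.WithBot.add_le_add_one_right_iff.mp h

end RegularLocal

open IsLocalRing in
theorem IsRegSystemOfParams.isDomain {n : ℕ} : ∀ {R : Type*} [CommRing R] [IsLocalRing R]
    [IsNoetherianRing R] {v : Fin n → R}, IsRegSystemOfParams v → IsDomain R := by
  induction n with
  | zero =>
    intro R _ _ _ v hv
    have h := hv.1
    rw [Set.range_eq_empty, Ideal.span_empty] at h
    exact (isField_iff_maximalIdeal_eq.mpr h.symm).isDomain
  | succ n ih =>
    intro R _ _ _ v hv
    obtain ⟨x, hx, hx2⟩ : ∃ x ∈ maximalIdeal R, x ∉ maximalIdeal R ^ 2 ∧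
        ∀ p ∈ minimalPrimes R, x ∉ p := by
      by_contra! h
      have hfin := minimalPrimes.finite_of_isNoetherianRing R
      have hsub : (maximalIdeal R : Set R) ⊆ ⋃ p ∈ (↑(insert (maximalIdeal R ^ 2)
          hfin.toFinset) : Set (Ideal R)), (p : Set R) := by
        intro x hx
        by_cases hx2 : x ∈ maximalIdeal R ^ 2
        · simp only [Set.mem_iUnion]
          exact ⟨_, by simp, hx2⟩
        · obtain ⟨p, hp, hxp⟩ := h x hx hx2
          simp only [Set.mem_iUnion]
          exact ⟨p, by simp [hp], hxp⟩
      obtain ⟨p, hp, hmp⟩ := (Ideal.subset_union_prime (maximalIdeal R ^ 2) (maximalIdeal R ^ 2)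
        (f := id) (fun p hp h1 _ => by
          simp only [Finset.mem_insert, h1, false_or, Set.Finite.mem_toFinset] at hp
          exact hp.1.1)).mp hsub
      simp only [Finset.mem_insert, Set.Finite.mem_toFinset] at hp
      rcases hp with rfl | hp
      · refine maximalIdeal_ne_bot_of_ringKrullDim hv.2 ?_
        refine Submodule.eq_bot_of_le_smul_of_le_jacobson_bot (maximalIdeal R) _
          (IsNoetherian.noetherian _) ?_ (maximalIdeal_le_jacobson _)
        simpa [pow_two] using hmp
      · have : p.IsPrime := hp.1.1
        have hpm : p = maximalIdeal R := le_antisymm (le_maximalIdeal this.ne_top) hmp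
        have h0 : (maximalIdeal R).height = 0 := by
          rw [← hpm]
          exact Ideal.height_eq_zero_iff.mpr hp
        have h1 := maximalIdeal_height_eq_ringKrullDim (R := R)
        rw [h0, hv.2] at h1
        norm_cast at h1
    have := Fact.mk hx
    obtain ⟨i, hi⟩ := maximalIdeal_le_span_singleton_sup hv hx hx2.1
    have hdom := ih (IsRegSystemOfParams.quotient hi (fun j => hv.mem _) hv.2)
    have hprime : (Ideal.span {x}).IsPrime := (Ideal.Quotient.isDomain_iff_prime _).mp hdom
    obtain ⟨p, hp, hpx⟩ := Ideal.exists_minimalPrimes_le (bot_le (a := Ideal.span {x}))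
    have hpp : p.IsPrime := hp.1.1
    have hp0 : p = ⊥ := by
      refine Submodule.eq_bot_of_le_smul_of_le_jacobson_bot (Ideal.span {x}) _
        (IsNoetherian.noetherian _) ?_ ?_
      · intro y hy
        obtain ⟨z, rfl⟩ := Ideal.mem_span_singleton'.mp (hpx hy)
        rw [mul_comm]
        exact Submodule.smul_mem_smul (Ideal.mem_span_singleton_self x)
          ((hpp.mem_or_mem hy).resolve_right (hx2.2 p hp))
      · rw [Ideal.span_singleton_le_iff_mem]
        exact maximalIdeal_le_jacobson _ hx
    subst hp0
    exact IsDomain.of_bot_isPrime R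

section RegularSequence

open IsLocalRing RingTheory.Sequence
open scoped Pointwise

theorem IsRegSystemOfParams.isWeaklyRegular {n : ℕ} : ∀ {R : Type*} [CommRing R] [IsLocalRing R]
    [IsNoetherianRing R] {v : Fin n → R}, IsRegSystemOfParams v →
    IsWeaklyRegular R (List.ofFn v) := by
  induction n with
  | zero =>
    intro R _ _ _ v _
    simp
  | succ n ih =>
    intro R _ _ _ v hv
    have hdom := hv.isDomain
    have := Fact.mk (hv.mem 0)
    have h0 : v 0 ≠ 0 := by
      intro h0
      have hspan : Ideal.span (Set.range fun i : Fin n => v i.succ) = maximalIdeal R := by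
        refine le_antisymm (Ideal.span_le.mpr (Set.range_subset_iff.mpr fun i => hv.mem _)) ?_
        rw [← hv.1, Ideal.span_le, Set.range_subset_iff]
        intro i
        cases i using Fin.cases with
        | zero => simp [h0]
        | succ i => exact Ideal.subset_span ⟨i, rfl⟩
      have := ringKrullDim_le_of_span_range_eq_maximalIdeal hspan
      rw [hv.2] at this
      norm_cast at this
      omega
    have hq := ih (IsRegSystemOfParams.quotient (x := v 0) (t := fun i : Fin n => v i.succ) (by
      rw [← hv.1, Ideal.span_le, Set.range_subset_iff]
      intro i
      cases i using Fin.cases with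
      | zero => exact Ideal.mem_sup_left (Ideal.mem_span_singleton_self _)
      | succ i => exact Ideal.mem_sup_right (Ideal.subset_span ⟨i, rfl⟩))
      (fun i => hv.mem _) hv.2)
    rw [List.ofFn_succ, isWeaklyRegular_cons_iff']
    refine ⟨IsSMulRegular.of_ne_zero h0, ?_⟩
    let e : (R ⧸ Ideal.span {v 0}) ≃ₗ[R ⧸ Ideal.span {v 0}] QuotSMulTop (v 0) R :=
      (Submodule.quotEquivOfEq (Ideal.span {v 0}) (v 0 • ⊤) (by
        rw [← Submodule.ideal_span_singleton_smul]
        simp)).extendScalarsOfSurjective Ideal.Quotient.mk_surjective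
    rw [← e.isWeaklyRegular_congr, List.map_ofFn]
    exact hq

variable {R : Type*} [CommRing R] [IsLocalRing R] [IsNoetherianRing R]

theorem isWeaklyRegular_map_pow {ι : Type*} {v : ι → R} (hv : ∀ i, v i ∈ maximalIdeal R)
    (b : ι → ℕ) (l₂ : List ι) : ∀ l₁ : List R, (∀ r ∈ l₁, r ∈ maximalIdeal R) →
      IsWeaklyRegular R (l₁ ++ l₂.map v) →
      IsWeaklyRegular R (l₁ ++ l₂.map fun i => v i ^ (b i + 1)) := by
  induction l₂ with
  | nil => intro l₁ _ h; simpa using h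
  | cons i l₂ ih =>
    intro l₁ hl₁ h
    have hl₂ : ∀ r ∈ l₂.map v, r ∈ maximalIdeal R := by
      intro r hr
      obtain ⟨j, -, rfl⟩ := List.mem_map.mp hr
      exact hv j
    have h1 : IsWeaklyRegular R ((l₁ ++ l₂.map v) ++ [v i]) := by
      refine isWeaklyRegular_of_perm_of_subset_maximalIdeal h ?_ ?_
      · rw [List.map_cons]
        exact List.perm_middle.trans (List.perm_append_singleton _ _).symm
      · intro r hr
        rw [List.map_cons, List.mem_append, List.mem_cons] at hr
        rcases hr with hr | rfl | hr
        exacts [hl₁ r hr, hv i, hl₂ r hr]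
    rw [isWeaklyRegular_append_iff, isWeaklyRegular_singleton_iff] at h1
    have h2 : IsWeaklyRegular R ((l₁ ++ l₂.map v) ++ [v i ^ (b i + 1)]) := by
      rw [isWeaklyRegular_append_iff, isWeaklyRegular_singleton_iff]
      exact ⟨h1.1, h1.2.pow _⟩
    have hp : v i ^ (b i + 1) ∈ maximalIdeal R := Ideal.pow_mem_of_mem _ (hv i) _ (by omega)
    have h3 : IsWeaklyRegular R ((l₁ ++ [v i ^ (b i + 1)]) ++ l₂.map v) := by
      refine isWeaklyRegular_of_perm_of_subset_maximalIdeal h2 ?_ ?_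
      · rw [List.append_assoc, List.append_assoc]
        exact List.perm_append_comm.append_left _
      · intro r hr
        rw [List.mem_append, List.mem_append, List.mem_singleton] at hr
        rcases hr with (hr | hr) | rfl
        exacts [hl₁ r hr, hl₂ r hr, hp]
    have := ih _ (by
      intro r hr
      rw [List.mem_append, List.mem_singleton] at hr
      rcases hr with hr | rfl
      exacts [hl₁ r hr, hp]) h3
    simpa using this

theorem IsRegSystemOfParams.mem_of_mul_mem {n : ℕ} {v : Fin n → R} (hv : IsRegSystemOfParams v)
    (b : Fin n → ℕ) (i : Fin n) {x : R}
    (h : v i * x ∈ Ideal.span ((fun j => v j ^ (b j + 1)) '' {j | j ≠ i})) :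
    x ∈ Ideal.span ((fun j => v j ^ (b j + 1)) '' {j | j ≠ i}) := by
  set L := (List.finRange n).erase i
  have h1 : IsWeaklyRegular R ([v i] ++ L.map v) := by
    refine isWeaklyRegular_of_perm_of_subset_maximalIdeal hv.isWeaklyRegular ?_ ?_
    · rw [List.ofFn_eq_map]
      exact (List.perm_cons_erase (List.mem_finRange i)).map v
    · intro r hr
      obtain ⟨j, rfl⟩ := (List.mem_ofFn' _ _).mp hr
      exact hv.mem j
  have h2 := isWeaklyRegular_map_pow hv.mem b L [v i] (by simpa using hv.mem i) h1
  have h3 := isWeaklyRegular_of_perm_of_subset_maximalIdeal h2 List.perm_append_comm (by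
    intro r hr
    rw [List.mem_append, List.mem_singleton] at hr
    rcases hr with rfl | hr
    · exact hv.mem i
    · obtain ⟨j, -, rfl⟩ := List.mem_map.mp hr
      exact Ideal.pow_mem_of_mem _ (hv.mem j) _ (by omega))
  rw [isWeaklyRegular_append_iff, isWeaklyRegular_singleton_iff] at h3
  have hI : Ideal.ofList (L.map fun i => v i ^ (b i + 1)) =
      Ideal.span ((fun j => v j ^ (b j + 1)) '' {j | j ≠ i}) := by
    rw [Ideal.ofList]
    congr 1
    ext y
    simp [L, (List.nodup_finRange n).mem_erase_iff]
  rw [hI] at h3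
  have h4 := h3.2 (a₁ := Submodule.Quotient.mk x) (a₂ := 0) (by
    simp only [smul_zero]
    rw [← Submodule.Quotient.mk_smul, Submodule.Quotient.mk_eq_zero]
    simpa using h)
  rw [Submodule.Quotient.mk_eq_zero] at h4
  simpa using h4

theorem IsRegSystemOfParams.mem_of_pow_mul_mem {n : ℕ} {v : Fin n → R}
    (hv : IsRegSystemOfParams v) (b : Fin n → ℕ) (i : Fin n) (m : ℕ) {x : R}
    (h : v i ^ m * x ∈ Ideal.span ((fun j => v j ^ (b j + 1)) '' {j | j ≠ i})) :
    x ∈ Ideal.span ((fun j => v j ^ (b j + 1)) '' {j | j ≠ i}) := by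
  induction m with
  | zero => simpa using h
  | succ m ih =>
    rw [pow_succ', mul_assoc] at h
    exact ih (hv.mem_of_mul_mem b i h)

theorem IsRegSystemOfParams.mem_maximalIdeal_of_prod_mul_mem {n : ℕ} {v : Fin n → R}
    (hv : IsRegSystemOfParams v) (c : Fin n → ℕ) (s : Finset (Fin n)) {x : R}
    (h : (∏ j ∈ s, v j ^ c j) * x ∈
      Ideal.span (Set.range fun j => v j ^ ((if j ∈ s then c j else 0) + 1))) :
    x ∈ maximalIdeal R := by
  induction s using Finset.induction_on with
  | empty => simpa [hv.1] using h
  | insert i s hi ih =>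
    refine ih ?_
    set b : Fin n → ℕ := fun j => if j ∈ s then c j else 0 with hb
    obtain ⟨r, hr⟩ := Ideal.mem_span_range_iff_exists_fun.mp h
    have hJ : v i ^ c i * ((∏ j ∈ s, v j ^ c j) * x - r i * v i) ∈
        Ideal.span ((fun j => v j ^ (b j + 1)) '' {j | j ≠ i}) := by
      rw [← Finset.add_sum_erase _ _ (Finset.mem_univ i), Finset.prod_insert hi] at hr
      have hsum : v i ^ c i * ((∏ j ∈ s, v j ^ c j) * x - r i * v i) =
          ∑ j ∈ Finset.univ.erase i, r j * v j ^ ((if j ∈ insert i s then c j else 0) + 1) := by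
        simp only [Finset.mem_insert_self, if_true] at hr
        linear_combination -hr
      rw [hsum]
      refine Ideal.sum_mem _ fun j hj => Ideal.mul_mem_left _ _ (Ideal.subset_span ⟨j, ?_⟩)
      have hji : j ≠ i := Finset.ne_of_mem_erase hj
      simp [hb, hji]
    have hle : Ideal.span ((fun j => v j ^ (b j + 1)) '' {j | j ≠ i}) ≤
        Ideal.span (Set.range fun j => v j ^ (b j + 1)) :=
      Ideal.span_mono (Set.image_subset_range _ _)
    have h1 := hle (hv.mem_of_pow_mul_mem b i _ hJ)
    have h2 : r i * v i ∈ Ideal.span (Set.range fun j => v j ^ (b j + 1)) :=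
      Ideal.mul_mem_left _ _ (Ideal.subset_span ⟨i, by simp [hb, hi]⟩)
    exact (Submodule.sub_mem_iff_left _ h2).mp h1

/-- A monomial in a regular system of parameters does not lie in the ideal generated by the
powers of the parameters with larger exponents. -/
theorem IsRegSystemOfParams.prod_pow_notMem {n : ℕ} {v : Fin n → R}
    (hv : IsRegSystemOfParams v) (c : Fin n → ℕ) :
    ∏ j, v j ^ c j ∉ Ideal.span (Set.range fun j => v j ^ (c j + 1)) := by
  intro h
  have := hv.mem_maximalIdeal_of_prod_mul_mem c Finset.univ (x := 1) (by simpa using h)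
  exact (Ideal.ne_top_iff_one _).mp (maximalIdeal.isMaximal R).ne_top this

end RegularSequence

/-- The ideal generated by the monomials in `v` of weight at least `d`. -/
def weightedMonomialIdeal {R ι : Type*} [CommRing R] [Fintype ι] (v : ι → R) (ω : ι → ℕ)
    (d : ℕ) : Ideal R :=
  Ideal.span {x | ∃ c : ι → ℕ, d ≤ ∑ i, c i * ω i ∧ x = ∏ i, v i ^ c i}

section WeightedMonomialIdeal

variable {R ι : Type*} [CommRing R] [Fintype ι] {v : ι → R} {ω : ι → ℕ}

theorem prod_pow_mem_weightedMonomialIdeal {d : ℕ} (c : ι → ℕ) (h : d ≤ ∑ i, c i * ω i) :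
    ∏ i, v i ^ c i ∈ weightedMonomialIdeal v ω d :=
  Ideal.subset_span ⟨c, h, rfl⟩

theorem pow_mem_weightedMonomialIdeal_of_le {d : ℕ} (i : ι) (b : ℕ) (h : d ≤ b * ω i) :
    v i ^ b ∈ weightedMonomialIdeal v ω d := by
  classical
  have := prod_pow_mem_weightedMonomialIdeal (v := v) (ω := ω) (d := d) (Pi.single i b)
    (by simpa [Pi.single_apply] using h)
  simpa [Pi.single_apply, pow_ite] using this

theorem weightedMonomialIdeal_le_iff {d : ℕ} {I : Ideal R} :
    weightedMonomialIdeal v ω d ≤ I ↔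
      ∀ c : ι → ℕ, d ≤ ∑ i, c i * ω i → ∏ i, v i ^ c i ∈ I := by
  rw [weightedMonomialIdeal, Ideal.span_le]
  exact ⟨fun h c hc => h ⟨c, hc, rfl⟩, by rintro h _ ⟨c, hc, rfl⟩; exact h c hc⟩

theorem weightedMonomialIdeal_anti {d e : ℕ} (h : d ≤ e) :
    weightedMonomialIdeal v ω e ≤ weightedMonomialIdeal v ω d :=
  weightedMonomialIdeal_le_iff.mpr fun c hc => prod_pow_mem_weightedMonomialIdeal c (h.trans hc)

theorem weightedMonomialIdeal_zero : weightedMonomialIdeal v ω 0 = ⊤ :=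
  (Ideal.eq_top_iff_one _).mpr <| by
    simpa using prod_pow_mem_weightedMonomialIdeal (v := v) (ω := ω) 0 (Nat.zero_le _)

theorem weightedMonomialIdeal_mul_le (d e : ℕ) :
    weightedMonomialIdeal v ω d * weightedMonomialIdeal v ω e ≤
      weightedMonomialIdeal v ω (d + e) := by
  rw [weightedMonomialIdeal, weightedMonomialIdeal, Ideal.span_mul_span', Ideal.span_le]
  rintro _ ⟨_, ⟨c, hc, rfl⟩, _, ⟨c', hc', rfl⟩, rfl⟩
  have := prod_pow_mem_weightedMonomialIdeal (v := v) (ω := ω) (d := d + e) (c + c') (by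
    simp only [Pi.add_apply, add_mul, Finset.sum_add_distrib]
    omega)
  simpa [pow_add, Finset.prod_mul_distrib] using this

theorem weightedMonomialIdeal_pow_le (d p : ℕ) :
    weightedMonomialIdeal v ω d ^ p ≤ weightedMonomialIdeal v ω (p * d) := by
  induction p with
  | zero => simp [weightedMonomialIdeal_zero]
  | succ p ih =>
    rw [pow_succ, Nat.succ_mul]
    exact (Ideal.mul_mono_left ih).trans (weightedMonomialIdeal_mul_le _ _)

theorem pow_mem_weightedMonomialIdeal {d : ℕ} {f : R} (hf : f ∈ weightedMonomialIdeal v ω d)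
    (p : ℕ) : f ^ p ∈ weightedMonomialIdeal v ω (p * d) :=
  weightedMonomialIdeal_pow_le d p (Ideal.pow_mem_pow hf p)

theorem sub_pow_mem_weightedMonomialIdeal {d : ℕ} {f g : R}
    (hf : f ∈ weightedMonomialIdeal v ω d) (hg : g ∈ weightedMonomialIdeal v ω d)
    (hfg : f - g ∈ weightedMonomialIdeal v ω (d + 1)) (p : ℕ) :
    f ^ p - g ^ p ∈ weightedMonomialIdeal v ω (p * d + 1) := by
  induction p with
  | zero => simp
  | succ p ih =>
    have h1 := weightedMonomialIdeal_mul_le _ _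
      (Ideal.mul_mem_mul (pow_mem_weightedMonomialIdeal hf p) hfg)
    have h2 := weightedMonomialIdeal_mul_le _ _ (Ideal.mul_mem_mul ih hg)
    have e : f ^ (p + 1) - g ^ (p + 1) = f ^ p * (f - g) + (f ^ p - g ^ p) * g := by ring
    rw [e]
    exact add_mem (weightedMonomialIdeal_anti (by linarith) h1)
      (weightedMonomialIdeal_anti (by linarith) h2)

theorem finsupp_weight_eq_sum (c : ι →₀ ℕ) : Finsupp.weight ω c = ∑ i, c i * ω i := by
  simp [Finsupp.weight_apply, Finsupp.sum_fintype]

theorem MvPolynomial.IsWeightedHomogeneous.eval_mem_weightedMonomialIdeal {d : ℕ}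
    {F : MvPolynomial ι R} (hF : F.IsWeightedHomogeneous ω d) :
    MvPolynomial.eval v F ∈ weightedMonomialIdeal v ω d := by
  rw [MvPolynomial.eval_eq']
  refine Ideal.sum_mem _ fun c hc => Ideal.mul_mem_left _ _ ?_
  refine prod_pow_mem_weightedMonomialIdeal c ?_
  rw [← finsupp_weight_eq_sum, hF (MvPolynomial.mem_support_iff.mp hc)]

theorem exists_isWeightedHomogeneous_sub_eval_mem {d : ℕ} {f : R}
    (hf : f ∈ weightedMonomialIdeal v ω d) :
    ∃ F : MvPolynomial ι R, F.IsWeightedHomogeneous ω d ∧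
      f - MvPolynomial.eval v F ∈ weightedMonomialIdeal v ω (d + 1) := by
  refine Submodule.span_induction ?_ ?_ ?_ ?_ hf
  · rintro _ ⟨c, hc, rfl⟩
    rcases hc.eq_or_lt with h | h
    · refine ⟨MvPolynomial.monomial (Finsupp.equivFunOnFinite.symm c) 1,
        MvPolynomial.isWeightedHomogeneous_monomial _ _ _ ?_, ?_⟩
      · rw [finsupp_weight_eq_sum, h]
        rfl
      · rw [MvPolynomial.eval_monomial, Finsupp.prod_fintype _ _ (by simp)]
        simp
    · refine ⟨0, MvPolynomial.isWeightedHomogeneous_zero _ _ _, ?_⟩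
      simpa using prod_pow_mem_weightedMonomialIdeal c h
  · exact ⟨0, MvPolynomial.isWeightedHomogeneous_zero _ _ _, by simp⟩
  · rintro x y - - ⟨F, hF, hx⟩ ⟨G, hG, hy⟩
    refine ⟨F + G, hF.add hG, ?_⟩
    rw [map_add, add_sub_add_comm]
    exact add_mem hx hy
  · rintro r x - ⟨F, hF, hx⟩
    refine ⟨MvPolynomial.C r * F, ?_, ?_⟩
    · simpa using (MvPolynomial.isWeightedHomogeneous_C ω r).mul hF
    · rw [map_mul, MvPolynomial.eval_C, smul_eq_mul, ← mul_sub]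
      exact Ideal.mul_mem_left _ _ hx

theorem prod_pow_mem_span_of_not_le {c c' : ι → ℕ} (h : ¬ c' ≤ c) :
    ∏ i, v i ^ c' i ∈ Ideal.span (Set.range fun j => v j ^ (c j + 1)) := by
  obtain ⟨i, hi⟩ := not_forall.mp h
  refine Ideal.mem_of_dvd _ ((pow_dvd_pow (v i) (not_le.mp hi)).trans
    (Finset.dvd_prod_of_mem (fun i => v i ^ c' i) (Finset.mem_univ i))) ?_
  exact Ideal.subset_span ⟨i, rfl⟩

end WeightedMonomialIdeal

section AnalyticIndependence

open IsLocalRing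

variable {R : Type*} [CommRing R] [IsLocalRing R] {n : ℕ} {v : Fin n → R}
  {ω : Fin n → ℕ}

/-- Weighted homogeneous forms of degree `d` which take a value of weight greater than `d`
on a regular system of parameters have all their coefficients in the maximal ideal. -/
theorem IsRegSystemOfParams.coeff_mem_maximalIdeal [IsNoetherianRing R]
    (hv : IsRegSystemOfParams v) (hω : ∀ i, 0 < ω i) {d : ℕ} {F : MvPolynomial (Fin n) R}
    (hF : F.IsWeightedHomogeneous ω d)
    (h : MvPolynomial.eval v F ∈ weightedMonomialIdeal v ω (d + 1)) (c : Fin n →₀ ℕ) :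
    F.coeff c ∈ maximalIdeal R := by
  by_contra hc
  have hu : IsUnit (F.coeff c) := by simpa using hc
  have hcs : c ∈ F.support := MvPolynomial.mem_support_iff.mpr fun h0 => hc (h0 ▸ zero_mem _)
  have hcd := hF (MvPolynomial.mem_support_iff.mp hcs)
  rw [finsupp_weight_eq_sum] at hcd
  refine hv.prod_pow_notMem c ((Ideal.unit_mul_mem_iff_mem _ hu).mp ?_)
  rw [MvPolynomial.eval_eq', ← Finset.add_sum_erase _ _ hcs] at h
  have hle : weightedMonomialIdeal v ω (d + 1) ≤
      Ideal.span (Set.range fun j => v j ^ (c j + 1)) := by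
    refine weightedMonomialIdeal_le_iff.mpr fun c' hc' => prod_pow_mem_span_of_not_le fun hle => ?_
    have := Finset.sum_le_sum fun i (_ : i ∈ Finset.univ) => Nat.mul_le_mul_right (ω i) (hle i)
    omega
  refine (Ideal.add_mem_iff_left _ ?_).mp (hle h)
  refine Ideal.sum_mem _ fun c' hc' => Ideal.mul_mem_left _ _ ?_
  obtain ⟨hne, hc's⟩ := Finset.mem_erase.mp hc'
  refine prod_pow_mem_span_of_not_le fun hle => hne ?_
  have hcd' := hF (MvPolynomial.mem_support_iff.mp hc's)
  rw [finsupp_weight_eq_sum, ← hcd] at hcd'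
  ext i
  have := (Finset.sum_eq_sum_iff_of_le fun i _ => Nat.mul_le_mul_right (ω i) (hle i)).mp hcd' i
    (Finset.mem_univ i)
  exact Nat.eq_of_mul_eq_mul_right (hω i) this

theorem eval_mem_weightedMonomialIdeal_of_coeff_mem (hv : Ideal.span (Set.range v) = maximalIdeal R)
    (hω : ∀ i, 0 < ω i) {d : ℕ} {F : MvPolynomial (Fin n) R} (hF : F.IsWeightedHomogeneous ω d)
    (h : ∀ c, F.coeff c ∈ maximalIdeal R) :
    MvPolynomial.eval v F ∈ weightedMonomialIdeal v ω (d + 1) := by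
  have hm : maximalIdeal R ≤ weightedMonomialIdeal v ω 1 := by
    rw [← hv, Ideal.span_le, Set.range_subset_iff]
    intro i
    simpa using pow_mem_weightedMonomialIdeal_of_le (v := v) (ω := ω) (d := 1) i 1
      (by rw [one_mul]; exact hω i)
  rw [MvPolynomial.eval_eq']
  refine Ideal.sum_mem _ fun c hc => ?_
  rw [add_comm d 1]
  refine weightedMonomialIdeal_mul_le _ _ (Ideal.mul_mem_mul (hm (h c))
    (prod_pow_mem_weightedMonomialIdeal c ?_))
  rw [← finsupp_weight_eq_sum, hF (MvPolynomial.mem_support_iff.mp hc)]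

/-- The graded ring of the weight filtration of a regular system of parameters is reduced. -/
theorem IsRegSystemOfParams.mem_weightedMonomialIdeal_succ [IsNoetherianRing R]
    (hv : IsRegSystemOfParams v) (hω : ∀ i, 0 < ω i) {d p : ℕ} {f : R}
    (hf : f ∈ weightedMonomialIdeal v ω d)
    (hfp : f ^ p ∈ weightedMonomialIdeal v ω (p * d + 1)) :
    f ∈ weightedMonomialIdeal v ω (d + 1) := by
  obtain ⟨F, hF, hfF⟩ := exists_isWeightedHomogeneous_sub_eval_mem hf
  have hFp : MvPolynomial.eval v (F ^ p) ∈ weightedMonomialIdeal v ω (p * d + 1) := by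
    rw [map_pow]
    exact (Submodule.sub_mem_iff_right _ hfp).mp
      (sub_pow_mem_weightedMonomialIdeal hf hF.eval_mem_weightedMonomialIdeal hfF p)
  have hcoeff := hv.coeff_mem_maximalIdeal hω (by simpa using hF.pow p) hFp
  have hzero : MvPolynomial.map (residue R) F = 0 := by
    refine eq_zero_of_pow_eq_zero (n := p) ?_
    rw [← map_pow]
    ext c
    rw [MvPolynomial.coeff_map, MvPolynomial.coeff_zero, residue_eq_zero_iff]
    exact hcoeff c
  have hFe := eval_mem_weightedMonomialIdeal_of_coeff_mem hv.1 hω hF fun c => by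
    rw [← residue_eq_zero_iff, ← MvPolynomial.coeff_map, hzero, MvPolynomial.coeff_zero]
  exact (Submodule.sub_mem_iff_left _ hFe).mp hfF

end AnalyticIndependence

section IntegralClosure

variable {R : Type*} [CommRing R]

theorem IsRegSystemOfParams.mem_weightedMonomialIdeal_of_integral [IsLocalRing R]
    [IsNoetherianRing R] {n : ℕ} {v : Fin n → R} {ω : Fin n → ℕ}
    (hv : IsRegSystemOfParams v) (hω : ∀ i, 0 < ω i) {J : Ideal R} {s M t : ℕ} {f : R}
    (hJ : J ≤ weightedMonomialIdeal v ω s) (hf : MemIntegralClosureOfIdeal J (f ^ M))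
    (hM : 0 < M) (ht : M * t ≤ s) :
    f ∈ weightedMonomialIdeal v ω t := by
  obtain ⟨p, hp, c, hc, heq⟩ := hf
  suffices ∀ d ≤ t, f ∈ weightedMonomialIdeal v ω d from this t le_rfl
  intro d
  induction d with
  | zero => simp [weightedMonomialIdeal_zero]
  | succ d ih =>
    intro hd
    have hfd := ih (by omega)
    refine hv.mem_weightedMonomialIdeal_succ hω hfd (p := M * p) ?_
    rw [pow_mul, eq_neg_of_add_eq_zero_left heq]
    refine neg_mem (Ideal.sum_mem _ fun i _ => ?_)
    have h1 : c i ∈ weightedMonomialIdeal v ω ((i + 1) * s) :=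
      weightedMonomialIdeal_pow_le _ _ (Ideal.pow_right_mono hJ _ (hc i))
    have h2 := pow_mem_weightedMonomialIdeal hfd (M * (p - 1 - i))
    rw [pow_mul] at h2
    refine weightedMonomialIdeal_anti ?_
      (weightedMonomialIdeal_mul_le _ _ (Ideal.mul_mem_mul h1 h2))
    obtain ⟨r, hr⟩ : ∃ r, p = i + 1 + r := ⟨p - (i + 1), by omega⟩
    have hr' : p - 1 - i = r := by omega
    have hs : M * d + 1 ≤ s := by nlinarith
    have hp' : M * p * d = (i + 1) * (M * d) + M * r * d := by
      conv_lhs => rw [hr]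
      ring
    rw [hr', hp']
    nlinarith [Nat.mul_le_mul_left ((i : ℕ) + 1) hs]

/-- The determinant trick for integral closures of ideals. -/
theorem memIntegralClosureOfIdeal_of_mul_mem [IsNoetherianRing R] [IsDomain R] {I K : Ideal R}
    (hK : K ≠ ⊥) {g : R} (h : ∀ x ∈ K, g * x ∈ I * K) : MemIntegralClosureOfIdeal I g := by
  have hrange : LinearMap.range (Algebra.lsmul R R K g) ≤ I • ⊤ := by
    rintro _ ⟨x, rfl⟩
    have hx : g * x ∈ (I • ⊤ : Submodule R K).map K.subtype := by
      rw [Submodule.map_smul'', Submodule.map_top, Submodule.range_subtype]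
      exact h x x.2
    obtain ⟨y, hy, hyx⟩ := hx
    have : Algebra.lsmul R R K g x = y := Subtype.ext hyx.symm
    exact this ▸ hy
  obtain ⟨p, hp, -, hcoeff, heval⟩ :=
    LinearMap.exists_monic_and_natDegree_eq_and_coeff_mem_pow_and_aeval_eq_zero R _ I hrange
  obtain ⟨x, hx, hx0⟩ := Submodule.exists_mem_ne_zero_of_ne_bot hK
  have hpg : p.eval g = 0 := by
    rw [Polynomial.aeval_algHom_apply] at heval
    have := congrArg Subtype.val (LinearMap.congr_fun heval ⟨x, hx⟩)
    simpa [hx0] using this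
  have hn : 0 < p.natDegree := by
    refine Nat.pos_of_ne_zero fun h0 => ?_
    rw [hp.natDegree_eq_zero.mp h0] at hpg
    simp at hpg
  refine ⟨p.natDegree, hn, fun i => p.coeff (p.natDegree - 1 - i), fun i => ?_, ?_⟩
  · have := hcoeff (p.natDegree - 1 - i)
    rwa [show p.natDegree - (p.natDegree - 1 - i) = i + 1 by omega] at this
  · rw [Polynomial.eval_eq_sum_range, Finset.sum_range_succ, hp.coeff_natDegree, one_mul] at hpg
    rw [Fin.sum_univ_eq_sum_range fun i => p.coeff (p.natDegree - 1 - i) * g ^ (p.natDegree - 1 - i),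
      Finset.sum_range_reflect fun i => p.coeff i * g ^ i, add_comm]
    exact hpg

variable {ι : Type*} [Fintype ι] {u : ι → R} {W b : ι → ℕ} {S : ℕ}

theorem weightedMonomialIdeal_add_le_mul (hb : ∀ i, b i * W i = S) {D : ℕ}
    (hD : Fintype.card ι * S ≤ D) (hS : 0 < S) :
    weightedMonomialIdeal u W (D + S) ≤
      Ideal.span (Set.range fun i => u i ^ b i) * weightedMonomialIdeal u W D := by
  classical
  refine weightedMonomialIdeal_le_iff.mpr fun c hc => ?_
  obtain ⟨i, hi⟩ : ∃ i, S ≤ c i * W i := by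
    by_contra! h
    have := Finset.sum_le_card_nsmul Finset.univ (fun i => c i * W i) S fun i _ => (h i).le
    simp only [Finset.card_univ, smul_eq_mul] at this
    omega
  have hbc : b i ≤ c i := by
    have hW : 0 < W i := Nat.pos_of_ne_zero fun h0 => by simp [h0] at hi; omega
    exact Nat.le_of_mul_le_mul_right ((hb i).trans_le hi) hW
  have hc' : c = Pi.single i (b i) + (c - Pi.single i (b i)) := by
    ext j
    by_cases hj : j = i
    · subst hj
      simp [hbc]
    · simp [hj]
  set c' := c - Pi.single i (b i)
  rw [hc'] at hc ⊢
  have hprod : ∏ j, u j ^ (Pi.single i (b i) + c' : ι → ℕ) j = u i ^ b i * ∏ j, u j ^ c' j := by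
    simp only [Pi.add_apply, pow_add, Finset.prod_mul_distrib]
    congr 1
    simp [Pi.single_apply, pow_ite]
  rw [hprod]
  refine Ideal.mul_mem_mul (Ideal.subset_span ⟨i, rfl⟩) (prod_pow_mem_weightedMonomialIdeal _ ?_)
  simp only [Pi.add_apply, add_mul, Finset.sum_add_distrib] at hc
  have : ∑ j, (Pi.single i (b i) : ι → ℕ) j * W j = S := by
    simp [Pi.single_apply, hb]
  omega

theorem weightedMonomialIdeal_add_le_pow_mul (hb : ∀ i, b i * W i = S) {D : ℕ}
    (hD : Fintype.card ι * S ≤ D) (hS : 0 < S) (l : ℕ) :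
    weightedMonomialIdeal u W (l * S + D) ≤
      Ideal.span (Set.range fun i => u i ^ b i) ^ l * weightedMonomialIdeal u W D := by
  induction l with
  | zero => simp
  | succ l ih =>
    rw [Nat.succ_mul, Nat.add_right_comm, pow_succ', mul_assoc]
    exact (weightedMonomialIdeal_add_le_mul hb (by omega) hS).trans (Ideal.mul_mono_right ih)

theorem memIntegralClosureOfIdeal_pow_of_mem [IsNoetherianRing R] [IsDomain R]
    (hu : ∀ i, u i ≠ 0) (hW : ∀ i, 0 < W i) (hb : ∀ i, b i * W i = S) (hS : 0 < S) {l : ℕ} {f : R}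
    (hf : f ∈ weightedMonomialIdeal u W l) :
    MemIntegralClosureOfIdeal (Ideal.span (Set.range fun i => u i ^ b i) ^ l) (f ^ S) := by
  refine memIntegralClosureOfIdeal_of_mul_mem
    (K := weightedMonomialIdeal u W (Fintype.card ι * S)) ?_ fun x hx => ?_
  · have hmem := prod_pow_mem_weightedMonomialIdeal (v := u) (ω := W)
      (d := Fintype.card ι * S) (fun _ => S) (by
        have := Finset.card_nsmul_le_sum Finset.univ (fun i => S * W i) S fun i _ =>
          Nat.le_mul_of_pos_right S (hW i)
        simpa using this)
    intro h0
    rw [h0, Ideal.mem_bot, Finset.prod_eq_zero_iff] at hmem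
    obtain ⟨i, -, hi⟩ := hmem
    exact hu i (eq_zero_of_pow_eq_zero hi)
  · refine weightedMonomialIdeal_add_le_pow_mul hb le_rfl hS l ?_
    rw [mul_comm l S]
    exact weightedMonomialIdeal_mul_le _ _
      (Ideal.mul_mem_mul (pow_mem_weightedMonomialIdeal hf S) hx)

end IntegralClosure

section Closedness

open IsLocalRing

variable {R : Type*} [CommRing R] [IsLocalRing R]

theorem mem_of_forall_mem_sup_maximalIdeal_pow [IsNoetherianRing R] {I : Ideal R} {f : R}
    (h : ∀ q, f ∈ I ⊔ maximalIdeal R ^ q) : f ∈ I := by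
  rw [← Ideal.Quotient.eq_zero_iff_mem, ← Submodule.mem_bot R,
    ← Ideal.iInf_pow_smul_eq_bot_of_isLocalRing (M := R ⧸ I) (maximalIdeal R)
      (maximalIdeal.isMaximal R).ne_top, Submodule.mem_iInf]
  intro q
  obtain ⟨x, hx, y, hy, rfl⟩ := Submodule.mem_sup.mp (h q)
  rw [map_add, Ideal.Quotient.eq_zero_iff_mem.mpr hx, zero_add]
  have : Ideal.Quotient.mk I y = y • (1 : R ⧸ I) := by
    rw [Algebra.smul_def, mul_one]
    rfl
  rw [this]
  exact Submodule.smul_mem_smul hy trivial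

theorem weightedMonomialIdeal_extend_le_sup {k n : ℕ} {v : Fin n → R}
    (hv : ∀ i, v i ∈ maximalIdeal R) (e : Fin k ↪ Fin n) (W : Fin k → ℕ) (l q : ℕ) :
    weightedMonomialIdeal v (Function.extend e (fun i => q * W i) 1) (l * q) ≤
      weightedMonomialIdeal (v ∘ e) W l ⊔ maximalIdeal R ^ q := by
  refine weightedMonomialIdeal_le_iff.mpr fun c hc => ?_
  have hc1 : ∀ j ∈ (Finset.univ.map e)ᶜ,
      c j * Function.extend e (fun i => q * W i) 1 j = c j := by
    intro j hj
    rw [Function.extend_apply' _ _ _ (by simpa using hj), Pi.one_apply, mul_one]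
  rw [← Finset.sum_add_sum_compl (Finset.univ.map e), Finset.sum_map, Finset.sum_congr rfl hc1] at hc
  simp only [e.injective.extend_apply] at hc
  rw [← Finset.prod_mul_prod_compl (Finset.univ.map e), Finset.prod_map]
  by_cases h : l ≤ ∑ i, c (e i) * W i
  · exact Ideal.mem_sup_left (Ideal.mul_mem_right _ _
      (prod_pow_mem_weightedMonomialIdeal (v := v ∘ e) (fun i => c (e i)) h))
  · refine Ideal.mem_sup_right (Ideal.mul_mem_left _ _ ?_)
    have hq : q ≤ ∑ j ∈ (Finset.univ.map e)ᶜ, c j := by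
      have : ∑ i, c (e i) * (q * W i) = (∑ i, c (e i) * W i) * q := by
        rw [Finset.sum_mul]
        exact Finset.sum_congr rfl fun i _ => by ring
      rw [this] at hc
      nlinarith
    refine Ideal.pow_le_pow_right hq ?_
    rw [← Finset.prod_pow_eq_pow_sum]
    exact Ideal.prod_mem_prod fun j _ => Ideal.pow_mem_pow (hv j) _

end Closedness

theorem Rat.le_natCast_iff_num_toNat_le (a : ℚ) (x : ℕ) :
    a ≤ x ↔ a.num.toNat ≤ x * a.den := by
  rw [Int.toNat_le, Rat.le_iff]
  simp

theorem monomialIdealQ_eq_weightedMonomialIdeal {R : Type*} [CommRing R] {k : ℕ} (u : Fin k → R)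
    (w : Fin k → ℕ) (a : ℚ) :
    monomialIdealQ u w a = weightedMonomialIdeal u (fun i => w i * a.den) a.num.toNat := by
  have h : ∀ c : Fin k → ℕ, a ≤ ∑ i, (c i : ℚ) * w i ↔
      a.num.toNat ≤ ∑ i, c i * (w i * a.den) := fun c => by
    have := Rat.le_natCast_iff_num_toNat_le a (∑ i, c i * w i)
    simpa only [Nat.cast_sum, Nat.cast_mul, Finset.sum_mul, mul_assoc] using this
  simp only [monomialIdealQ, weightedMonomialIdeal, h]

theorem IsRegSystemOfParams.ne_zero {R : Type*} [CommRing R] [IsLocalRing R] [IsNoetherianRing R]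
    {n : ℕ} {v : Fin n → R} (hv : IsRegSystemOfParams v) (i : Fin n) : v i ≠ 0 := by
  intro h0
  refine hv.prod_pow_notMem (Pi.single i 1) ?_
  rw [Finset.prod_eq_zero (Finset.mem_univ i) (by simp [h0])]
  exact zero_mem _

/-- Let `R` be a regular local ring, `u₁,…,u_k` part of a regular system of
parameters, `w₁,…,w_k` positive integer weights, and `a > 0` a rational number.  Writing the
`Q`-ideal `(u₁^{1/w₁},…,u_k^{1/w_k})` as `J^{1/N}` with `J = (u₁^{N/w₁},…,u_k^{N/w_k})` for `N`
divisible by all the `w i`, the ideal of sections of its `a`-th power, namely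
`{f : f^{a.den·N}` is integral over `J^{a.num}}`, equals the ideal generated by the monomials
`u₁^{c₁}⋯u_k^{c_k}` with `c₁ w₁ + ⋯ + c_k w_k ≥ a`, i.e. the ideal `{f : ν(f) ≥ a}` of the
monomial valuation `ν` with `ν (u i) = w i`. -/
theorem sections_of_rational_power_eq_monomial_ideal
    {R : Type*} [CommRing R] [IsLocalRing R] [IsNoetherianRing R] {k : ℕ}
    (u : Fin k → R) (w : Fin k → ℕ)
    (hu : IsPartialRegSystemOfParams u) (hw : ∀ i, 0 < w i)
    (a : ℚ) (ha : 0 < a)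
    (N : ℕ) (hN : 0 < N) (hNw : ∀ i, w i ∣ N) :
    {f : R |
        MemIntegralClosureOfIdeal
          ((Ideal.span (Set.range fun i => u i ^ (N / w i))) ^ a.num.toNat)
          (f ^ (a.den * N))} =
      ↑(monomialIdealQ u w a) := by
  obtain ⟨n, v, e, hve, hspan, hdim⟩ := hu
  have hv : IsRegSystemOfParams v := ⟨hspan, hdim⟩
  have hdom := hv.isDomain
  obtain rfl : v ∘ e = u := funext hve
  have hW : ∀ i, 0 < w i * a.den := fun i => Nat.mul_pos (hw i) a.den_pos
  have hb : ∀ i, N / w i * (w i * a.den) = a.den * N := fun i => by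
    rw [← mul_assoc, Nat.div_mul_cancel (hNw i), mul_comm]
  have hS : 0 < a.den * N := Nat.mul_pos a.den_pos hN
  rw [monomialIdealQ_eq_weightedMonomialIdeal]
  ext f
  refine ⟨fun hf => ?_, memIntegralClosureOfIdeal_pow_of_mem (fun i => hv.ne_zero _) hW hb hS⟩
  refine mem_of_forall_mem_sup_maximalIdeal_pow fun q => ?_
  rcases Nat.eq_zero_or_pos q with rfl | hq
  · simp
  refine weightedMonomialIdeal_extend_le_sup hv.mem e _ _ _ ?_
  set ω := Function.extend e (fun i => q * (w i * a.den)) 1 with hω_def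
  have hωe : ∀ i, ω (e i) = q * (w i * a.den) := e.injective.extend_apply _ _
  have hω : ∀ j, 0 < ω j := fun j => by
    by_cases hj : ∃ i, e i = j
    · obtain ⟨i, rfl⟩ := hj
      rw [hωe]
      exact Nat.mul_pos hq (hW i)
    · rw [hω_def, Function.extend_apply' _ _ _ hj]
      exact Nat.one_pos
  have hJ : Ideal.span (Set.range fun i => (v ∘ e) i ^ (N / w i)) ≤
      weightedMonomialIdeal v ω (q * (a.den * N)) := by
    rw [Ideal.span_le, Set.range_subset_iff]
    intro i
    refine pow_mem_weightedMonomialIdeal_of_le (e i) _ ?_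
    rw [hωe, ← hb i, mul_left_comm]
  exact hv.mem_weightedMonomialIdeal_of_integral hω
    ((Ideal.pow_right_mono hJ _).trans (weightedMonomialIdeal_pow_le _ _)) hf hS
    (by rw [mul_left_comm (a.den * N), mul_comm (a.den * N) q])
end

section
/- Let X be a regular scheme, u_1,...,u_k part of a regular system of parameters, and w_1,...,w_k positive integers with w = lcm of suitable data. Let A = O_X[u_1 t^{w_1},...,u_k t^{w_k}]^{int} be the integrally closed Rees algebra. Then A equals the nonnegative part (with respect to the t-grading) of the extended Rees algebra A^{ext} = O_X[t^{-1}, u_1 t^{w_1},...,u_k t^{w_k}]. -/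
open LaurentPolynomial

open IsLocalRing in
lemma ringKrullDim_le_card_of_span_eq_maximalIdeal {R ι : Type*} [CommRing R] [IsLocalRing R]
    [IsNoetherianRing R] (s : Finset ι) (v : ι → R)
    (hv : Ideal.span (v '' s) = maximalIdeal R) : ringKrullDim R ≤ s.card := by
  refine (ringKrullDim_le_spanFinrank_maximalIdeal R).trans ?_
  rw [← hv]
  have h := Submodule.spanFinrank_span_le_ncard_of_finite (R := R) (s.finite_toSet.image v)
  have h' := Set.ncard_image_le (f := v) s.finite_toSet
  rw [Set.ncard_coe_finset] at h'
  exact_mod_cast h.trans h'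

lemma ringKrullDim_le_ringKrullDim_quotient_span_image_add_card {R ι : Type*} [CommRing R]
    [IsLocalRing R] [IsNoetherianRing R] (s : Finset ι) (v : ι → R)
    (hv : v '' s ⊆ IsLocalRing.maximalIdeal R) :
    ringKrullDim R ≤ ringKrullDim (R ⧸ Ideal.span (v '' s)) + s.card := by
  refine (ringKrullDim_le_ringKrullDim_quotient_add_encard (v '' s) ?_).trans ?_
  · rwa [IsLocalRing.ringJacobson_eq_maximalIdeal]
  · gcongr
    have h' := Set.encard_image_le v (s : Set ι)
    rw [Set.encard_coe_eq_coe_finsetCard] at h'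
    exact_mod_cast h'

lemma IsLocalRing.maximalIdeal_quotient_eq_map {R : Type*} [CommRing R] [IsLocalRing R]
    (I : Ideal R) [IsLocalRing (R ⧸ I)] :
    maximalIdeal (R ⧸ I) = (maximalIdeal R).map (Ideal.Quotient.mk I) := by
  have : IsLocalHom (Ideal.Quotient.mk I) := .of_surjective _ Ideal.Quotient.mk_surjective
  rw [← maximalIdeal_comap (Ideal.Quotient.mk I),
    Ideal.map_comap_of_surjective _ Ideal.Quotient.mk_surjective]

lemma IsLocalRing.ringKrullDim_le_ringKrullDim_quotient_span_singleton_add_one {R : Type*}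
    [CommRing R] [IsLocalRing R] [IsNoetherianRing R] {x : R} (hx : x ∈ maximalIdeal R) :
    ringKrullDim R ≤ ringKrullDim (R ⧸ Ideal.span {x}) + 1 := by
  simpa using ringKrullDim_le_ringKrullDim_quotient_add_encard {x}
    (by simpa [ringJacobson_eq_maximalIdeal] using hx)

/-- If the Krull dimension is at least `n`, some prime quotient has dimension at least `n`. -/
lemma exists_isPrime_le_ringKrullDim_quotient {R : Type*} [CommRing R] {n : ℕ}
    (h : n ≤ ringKrullDim R) : ∃ P : Ideal R, P.IsPrime ∧ n ≤ ringKrullDim (R ⧸ P) := by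
  obtain ⟨l, hl⟩ := Order.le_krullDim_iff.mp h
  refine ⟨l.head.asIdeal, l.head.isPrime, ?_⟩
  rw [ringKrullDim_quotient]
  refine Order.le_krullDim_iff.mpr ⟨⟨l.length, fun i ↦ ⟨l i, ?_⟩, fun i ↦ l.step i⟩, hl⟩
  exact l.head_le i

open IsLocalRing in
/-- A Noetherian local ring whose maximal ideal is generated by at most `dim R` elements (that is,
a regular local ring) is a domain. -/
theorem IsLocalRing.isDomain_of_card_le_ringKrullDim {ι : Type*} (s : Finset ι) :
    ∀ {R : Type*} [CommRing R] [IsLocalRing R] [IsNoetherianRing R] (v : ι → R),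
      Ideal.span (v '' s) = maximalIdeal R → s.card ≤ ringKrullDim R → IsDomain R := by
  classical
  induction s using Finset.induction_on with
  | empty =>
    intro R _ _ _ v hv _
    have : IsField R := isField_iff_maximalIdeal_eq.mpr (by simpa using hv.symm)
    exact this.isDomain
  | insert a s ha ih =>
    intro R _ _ _ v hv hdim
    rw [Finset.card_insert_of_notMem ha] at hdim
    set x := v a with hx
    have hxm : x ∈ maximalIdeal R := hv ▸ Ideal.subset_span ⟨a, by simp, rfl⟩
    have hxtop : Ideal.span {x} ≠ ⊤ := by
      simpa [Ideal.span_singleton_eq_top] using hxm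
    have : Nontrivial (R ⧸ Ideal.span {x}) := Ideal.Quotient.nontrivial_iff.mpr hxtop
    have : IsLocalRing (R ⧸ Ideal.span {x}) :=
      .of_surjective' _ Ideal.Quotient.mk_surjective
    have hgen : Ideal.span ((fun i ↦ Ideal.Quotient.mk (Ideal.span {x}) (v i)) '' s) =
        maximalIdeal (R ⧸ Ideal.span {x}) := by
      have hx0 : Ideal.Quotient.mk (Ideal.span {x}) x = 0 := by simp
      rw [maximalIdeal_quotient_eq_map, ← hv, Ideal.map_span, Finset.coe_insert, Set.image_insert_eq,
        Set.image_insert_eq, ← hx, hx0, Ideal.span_insert_zero, Set.image_image]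
    have hle := ringKrullDim_le_ringKrullDim_quotient_span_singleton_add_one hxm
    have hdimx := ringKrullDim_le_card_of_span_eq_maximalIdeal s _ hgen
    have hdom : IsDomain (R ⧸ Ideal.span {x}) := by
      refine ih _ hgen ((ENat.WithBot.add_le_add_one_right_iff).mp ?_)
      exact_mod_cast hdim.trans hle
    obtain ⟨P, hP, hPdim⟩ := exists_isPrime_le_ringKrullDim_quotient hdim
    have hxP : x ∉ P := fun h ↦ by
      have := ringKrullDim_le_of_surjective
        (Ideal.Quotient.factor ((Ideal.span_singleton_le_iff_mem P).mpr h))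
        (Ideal.Quotient.factor_surjective _)
      have := (hPdim.trans this).trans hdimx
      norm_cast at this
      omega
    have hPx : P ≤ Ideal.span {x} := by
      intro p hp
      by_contra hpx
      have hreg : Ideal.Quotient.mk (Ideal.span {x}) p ∈ nonZeroDivisors _ :=
        mem_nonZeroDivisors_of_ne_zero (by rwa [Ne, Ideal.Quotient.eq_zero_iff_mem])
      have h1 := ringKrullDim_quotient_succ_le_of_nonZeroDivisor hreg
      have : Nontrivial (R ⧸ P) := Ideal.Quotient.nontrivial_iff.mpr hP.ne_top
      have : IsLocalRing (R ⧸ P) := .of_surjective' _ Ideal.Quotient.mk_surjective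
      have h2 := ringKrullDim_le_ringKrullDim_quotient_span_singleton_add_one
        (R := R ⧸ P) (x := Ideal.Quotient.mk P x)
        (maximalIdeal_quotient_eq_map P ▸ Ideal.mem_map_of_mem _ hxm)
      let f : R →+* (R ⧸ P) ⧸ Ideal.span {Ideal.Quotient.mk P x} :=
        (Ideal.Quotient.mk _).comp (Ideal.Quotient.mk P)
      have hf : Function.Surjective f :=
        Ideal.Quotient.mk_surjective.comp Ideal.Quotient.mk_surjective
      have hfx : Ideal.span {x} ≤ RingHom.ker f := by
        simp [Ideal.span_le, f, RingHom.mem_ker]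
      have hfp : f p = 0 := by simp [f, Ideal.Quotient.eq_zero_iff_mem.mpr hp]
      let g := Ideal.Quotient.lift (Ideal.span {x}) f fun a ha ↦ hfx ha
      have hg : Ideal.span {Ideal.Quotient.mk (Ideal.span {x}) p} ≤ RingHom.ker g := by
        rw [Ideal.span_singleton_le_iff_mem, RingHom.mem_ker]
        exact (Ideal.Quotient.lift_mk _ _ _).trans hfp
      have h3 := ringKrullDim_le_of_surjective (Ideal.Quotient.lift _ g fun a ha ↦ hg ha)
        (Ideal.Quotient.lift_surjective_of_surjective _ _
          (Ideal.Quotient.lift_surjective_of_surjective _ _ hf))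
      have h4 := (hPdim.trans h2).trans ((add_le_add_left h3 1).trans (h1.trans hdimx))
      norm_cast at h4
      omega
    have hPbot : P = ⊥ := by
      refine Submodule.eq_bot_of_le_smul_of_le_jacobson_bot (Ideal.span {x}) P
        (IsNoetherian.noetherian P) ?_ ?_
      · intro p hp
        obtain ⟨q, rfl⟩ := Ideal.mem_span_singleton.mp (hPx hp)
        exact Ideal.mul_mem_mul (Ideal.mem_span_singleton_self x)
          ((hP.mem_or_mem hp).resolve_left hxP)
      · rw [IsLocalRing.jacobson_eq_maximalIdeal _ bot_ne_top]
        simpa [Ideal.span_le] using hxm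
    have : (⊥ : Ideal R).IsPrime := hPbot ▸ hP
    exact IsDomain.of_bot_isPrime R

open IsLocalRing in
lemma IsLocalRing.isPrime_span_image_of_card_le_ringKrullDim {R ι : Type*} [DecidableEq ι]
    [CommRing R] [IsLocalRing R] [IsNoetherianRing R] {s t : Finset ι} (hts : t ⊆ s) (v : ι → R)
    (hv : Ideal.span (v '' s) = maximalIdeal R) (hs : s.card ≤ ringKrullDim R) :
    (Ideal.span (v '' t)).IsPrime := by
  have hsub : v '' t ⊆ maximalIdeal R := by
    rw [← hv]
    exact (Set.image_mono (by exact_mod_cast hts)).trans Ideal.subset_span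
  set I := Ideal.span (v '' t) with hI
  have hIm : I ≤ maximalIdeal R := Ideal.span_le.mpr hsub
  have : Nontrivial (R ⧸ I) :=
    Ideal.Quotient.nontrivial_iff.mpr fun h ↦ Ideal.IsPrime.ne_top' (top_le_iff.mp (h ▸ hIm))
  have : IsLocalRing (R ⧸ I) := .of_surjective' _ Ideal.Quotient.mk_surjective
  have hgen : Ideal.span ((fun i ↦ Ideal.Quotient.mk I (v i)) '' ↑(s \ t)) =
      maximalIdeal (R ⧸ I) := by
    rw [maximalIdeal_quotient_eq_map, ← hv, ← Finset.sdiff_union_of_subset hts, Finset.coe_union,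
      Set.image_union, Ideal.span_union, Ideal.map_sup, ← hI, Ideal.map_quotient_self, sup_bot_eq,
      Ideal.map_span, Set.image_image, Finset.sdiff_union_of_subset hts]
  refine (Ideal.Quotient.isDomain_iff_prime I).mp
    (isDomain_of_card_le_ringKrullDim (s \ t) _ hgen ?_)
  have h := hs.trans (ringKrullDim_le_ringKrullDim_quotient_span_image_add_card t v hsub)
  rw [← Finset.card_sdiff_add_card_eq_card hts, Nat.cast_add] at h
  exact ENat.WithBot.add_le_add_natCast_right_iff.mp h

open IsLocalRing in
lemma IsLocalRing.notMem_span_image_of_card_le_ringKrullDim {R ι : Type*} [DecidableEq ι]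
    [CommRing R] [IsLocalRing R] [IsNoetherianRing R] {s t : Finset ι} (hts : t ⊆ s) (v : ι → R)
    (hv : Ideal.span (v '' s) = maximalIdeal R) (hs : s.card ≤ ringKrullDim R)
    {i : ι} (hi : i ∈ s) (hit : i ∉ t) : v i ∉ Ideal.span (v '' t) := by
  intro h
  have hgen : Ideal.span (v '' ↑(s.erase i)) = maximalIdeal R := by
    refine le_antisymm ?_ ?_
    · rw [← hv]
      exact Ideal.span_mono (Set.image_mono (by exact_mod_cast s.erase_subset i))
    · rw [← hv, Ideal.span_le]
      rintro _ ⟨j, hj, rfl⟩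
      by_cases hji : j = i
      · subst hji
        refine Ideal.span_mono (Set.image_mono ?_) h
        exact_mod_cast Finset.subset_erase.mpr ⟨hts, hit⟩
      · exact Ideal.subset_span ⟨j, by simpa [hji] using hj, rfl⟩
  have := hs.trans (ringKrullDim_le_card_of_span_eq_maximalIdeal _ _ hgen)
  have := Finset.card_erase_lt_of_mem hi
  norm_cast at *
  omega

/-- Vanishing of the first Koszul homology: the linear relations on a sequence that is weakly
regular in every order are generated by the trivial ones. -/
theorem exists_eq_sum_sub_mul_of_sum_mul_eq_zero {A ι : Type*} [CommRing A] [DecidableEq ι]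
    (u : ι → A) (s : Finset ι)
    (hu : ∀ t ⊆ s, ∀ i ∈ s, i ∉ t → ∀ g, u i * g ∈ Ideal.span (u '' t) → g ∈ Ideal.span (u '' t))
    (g : ι → A) (hg : ∑ i ∈ s, u i * g i = 0) :
    ∃ c : ι → ι → A, ∀ i ∈ s, g i = ∑ j ∈ s, (c i j - c j i) * u j := by
  induction s using Finset.induction_on generalizing g with
  | empty => simp
  | insert a s ha ih =>
    rw [Finset.sum_insert ha] at hg
    have hga : g a ∈ Ideal.span (u '' s) := by
      refine hu s (Finset.subset_insert a s) a (Finset.mem_insert_self a s) ha _ ?_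
      rw [eq_neg_of_add_eq_zero_left hg]
      exact neg_mem (Ideal.sum_mem _ fun i hi ↦
        Ideal.mul_mem_right _ _ (Ideal.subset_span ⟨i, hi, rfl⟩))
    obtain ⟨b, hb⟩ : ∃ b : ι → A, ∑ i ∈ s, b i * u i = g a := by
      obtain ⟨b, hb⟩ := (Submodule.mem_span_image_finset_iff_exists_fun A).mp hga
      refine ⟨fun i ↦ if h : i ∈ s then b ⟨i, h⟩ else 0, ?_⟩
      rw [← hb, ← Finset.sum_coe_sort]
      simp
    obtain ⟨c, hc⟩ := ih (fun t ht i hi ↦ hu t (ht.trans (Finset.subset_insert a s)) i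
      (Finset.mem_insert_of_mem hi)) (fun i ↦ g i + u a * b i) (by
        rw [← hb, Finset.mul_sum, ← Finset.sum_add_distrib] at hg
        rw [← hg]
        exact Finset.sum_congr rfl fun i _ ↦ by ring)
    refine ⟨fun i j ↦ if j = a then 0 else if i = a then b j else c i j, fun i hi ↦ ?_⟩
    have hne : ∀ j ∈ s, j ≠ a := fun j hj h ↦ ha (h ▸ hj)
    rw [Finset.sum_insert ha]
    rcases Finset.mem_insert.mp hi with rfl | hi
    · rw [← hb]
      simp only [if_true, sub_self, zero_mul, zero_add, sub_zero]
      exact Finset.sum_congr rfl fun j hj ↦ by rw [if_neg (hne j hj)]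
    · have : ∑ j ∈ s, ((if j = a then 0 else if i = a then b j else c i j) -
          (if i = a then 0 else if j = a then b i else c j i)) * u j =
          ∑ j ∈ s, (c i j - c j i) * u j :=
        Finset.sum_congr rfl fun j hj ↦ by simp [hne j hj, hne i hi]
      rw [this, ← hc i hi]
      simp [hne i hi]
      ring

namespace MvPolynomial

lemma isPrime_map_C {R σ : Type*} [CommRing R] {I : Ideal R} (hI : I.IsPrime) :
    (I.map (C : R →+* MvPolynomial σ R)).IsPrime := by
  have : IsDomain (R ⧸ I) := Ideal.Quotient.isDomain I
  rw [← Ideal.Quotient.isDomain_iff_prime]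
  exact (quotientEquivQuotientMvPolynomial (σ := σ) I).symm.toMulEquiv.isDomain _

/-- A polynomial vanishing at `u` lies in the ideal generated by the `X i - u i`. -/
lemma exists_eq_sum_X_sub_C_mul {R σ : Type*} [CommRing R] [Fintype σ] (u : σ → R)
    {F : MvPolynomial σ R} (hF : eval u F = 0) :
    ∃ G : σ → MvPolynomial σ R, F = ∑ i, (X i - C (u i)) * G i := by
  let I : Ideal (MvPolynomial σ R) := Ideal.span (Set.range fun i ↦ X i - C (u i))
  have key : (Ideal.Quotient.mkₐ R I) = (Ideal.Quotient.mkₐ R I).comp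
      ((Algebra.ofId R _).comp (aeval u)) := by
    ext i
    simp only [AlgHom.comp_apply, aeval_X, Ideal.Quotient.mkₐ_eq_mk]
    exact Ideal.Quotient.eq.mpr (Ideal.subset_span ⟨i, rfl⟩)
  have hFI : F ∈ I := by
    rw [← Ideal.Quotient.eq_zero_iff_mem, ← Ideal.Quotient.mkₐ_eq_mk R, key]
    simp [hF]
  obtain ⟨G, hG⟩ := (Ideal.mem_span_range_iff_exists_fun).mp hFI
  exact ⟨G, by rw [← hG]; exact Finset.sum_congr rfl fun i _ ↦ mul_comm _ _⟩

variable {R σ : Type*} [CommRing R]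

lemma coeff_X_mul_eq_zero_of_weight {w : σ → ℕ} (hw : ∀ i, 0 < w i) {F : MvPolynomial σ R} {b : ℕ}
    (hF : ∀ d, Finsupp.weight w d < b → coeff d F = 0) (i : σ) {d : σ →₀ ℕ}
    (hd : Finsupp.weight w d ≤ b) : coeff d (X i * F) = 0 := by
  classical
  rw [coeff_X_mul']
  split_ifs with h
  · refine hF _ ?_
    have h1 : d = (d - Finsupp.single i 1) + Finsupp.single i 1 :=
      (Finsupp.sub_add_single_one_cancel (Finsupp.mem_support_iff.mp h)).symm
    rw [h1, map_add, Finsupp.weight_single] at hd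
    have := hw i
    simp only [one_smul] at hd
    omega
  · rfl

/-- If the ideals generated by subfamilies of `u` are prime and distinct, then the constant
polynomials `u i` form a weakly regular sequence in every order. -/
lemma map_C_weaklyRegular {u : σ → R}
    (hp : ∀ t : Finset σ, (Ideal.span (u '' t)).IsPrime)
    (hn : ∀ (t : Finset σ) (i : σ), i ∉ t → u i ∉ Ideal.span (u '' t))
    (t : Finset σ) (i : σ) (hi : i ∉ t) (g : MvPolynomial σ R)
    (hg : C (u i) * g ∈ Ideal.span ((fun i ↦ C (u i)) '' t)) :
    g ∈ Ideal.span ((fun i ↦ (C (u i) : MvPolynomial σ R)) '' t) := by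
  have h : Ideal.span ((fun i ↦ (C (u i) : MvPolynomial σ R)) '' t) =
      (Ideal.span (u '' t)).map C := by
    rw [Ideal.map_span, Set.image_image]
  rw [h] at hg ⊢
  refine ((isPrime_map_C (hp t)).mem_or_mem hg).resolve_left fun hC ↦ hn t i hi ?_
  simpa using mem_map_C_iff.mp hC 0

/-- If `F(u) = 0` and all monomials of `F` have weight at least `a`, then `F` is a combination of the `X i - u i` with coefficients whose monomials
have weight at least `a`. -/
lemma exists_eq_sum_X_sub_C_mul_of_weight [Fintype σ] {u : σ → R} {w : σ → ℕ} (hw : ∀ i, 0 < w i)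
    (hp : ∀ t : Finset σ, (Ideal.span (u '' t)).IsPrime)
    (hn : ∀ (t : Finset σ) (i : σ), i ∉ t → u i ∉ Ideal.span (u '' t))
    {F : MvPolynomial σ R} (hF : eval u F = 0) (a : ℕ)
    (ha : ∀ d, Finsupp.weight w d < a → coeff d F = 0) :
    ∃ G : σ → MvPolynomial σ R, F = ∑ i, (X i - C (u i)) * G i ∧
      ∀ i d, Finsupp.weight w d < a → coeff d (G i) = 0 := by
  classical
  induction a with
  | zero =>
    obtain ⟨G, hG⟩ := exists_eq_sum_X_sub_C_mul u hF
    exact ⟨G, hG, by simp⟩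
  | succ b ih =>
    obtain ⟨G, hFG, hG⟩ := ih fun d hd ↦ ha d (hd.trans b.lt_succ_self)
    have hrel : ∑ i, C (u i) * weightedHomogeneousComponent w b (G i) = 0 := by
      ext d
      rw [coeff_sum, coeff_zero]
      simp only [coeff_C_mul, coeff_weightedHomogeneousComponent]
      split_ifs with hd
      · have h := ha d (by omega)
        rw [hFG, coeff_sum] at h
        simp only [sub_mul, coeff_sub, coeff_C_mul,
          coeff_X_mul_eq_zero_of_weight hw (hG _) _ hd.le, zero_sub, Finset.sum_neg_distrib,
          neg_eq_zero] at h
        exact h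
      · simp
    obtain ⟨c, hc⟩ := exists_eq_sum_sub_mul_of_sum_mul_eq_zero (fun i ↦ C (u i)) Finset.univ
      (fun t _ i _ hi ↦ map_C_weaklyRegular hp hn t i hi) _ hrel
    let e : σ → σ → MvPolynomial σ R := fun i j ↦ weightedHomogeneousComponent w b (c i j)
    have he : ∀ i j d, Finsupp.weight w d < b → coeff d (e i j) = 0 := fun i j d hd ↦ by
      rw [coeff_weightedHomogeneousComponent, if_neg hd.ne]
    refine ⟨fun i ↦ G i + ∑ j, (e i j - e j i) * (X j - C (u j)), ?_, fun i d hd ↦ ?_⟩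
    · have hzero : ∑ i, ∑ j, (X i - C (u i)) * ((e i j - e j i) * (X j - C (u j))) = 0 := by
        simp only [sub_mul (e _ _), mul_sub (X _ - C (u _)) (_ * _), Finset.sum_sub_distrib]
        rw [sub_eq_zero, Finset.sum_comm]
        exact Finset.sum_congr rfl fun i _ ↦ Finset.sum_congr rfl fun j _ ↦ by ring
      simp only [mul_add, Finset.sum_add_distrib, Finset.mul_sum]
      rw [hzero, add_zero, ← hFG]
    · have hX : ∀ j, coeff d ((e i j - e j i) * (X j - C (u j))) =
          -(coeff d (e i j - e j i) * u j) := fun j ↦ by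
        rw [mul_sub, coeff_sub, mul_comm _ (X j), mul_comm _ (C _), coeff_C_mul, mul_comm (u j),
          coeff_X_mul_eq_zero_of_weight hw (F := e i j - e j i) (b := b) _ _ (by omega), zero_sub]
        intro d' hd'
        rw [coeff_sub, he i j d' hd', he j i d' hd', sub_zero]
      rw [coeff_add, coeff_sum]
      simp only [hX, Finset.sum_neg_distrib]
      rcases (Nat.lt_succ_iff.mp hd).lt_or_eq with hlt | heq
      · simp [hG i d hlt, he _ _ d hlt]
      · have h := congrArg (coeff d) (hc i (Finset.mem_univ i))
        rw [coeff_weightedHomogeneousComponent, if_pos heq, coeff_sum] at h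
        rw [h, add_neg_eq_zero]
        simp only [mul_comm _ (C _), coeff_C_mul, mul_comm (u _)]
        simp [e, coeff_weightedHomogeneousComponent, heq]

/-- Quasi-regularity with respect to the weights `w`: if `F(u) = 0` and all monomials of `F` have
weight at least `a`, the coefficients of `F` in weight `a` lie in the ideal `(u)`. -/
theorem coeff_mem_span_of_eval_eq_zero [Fintype σ] {u : σ → R} {w : σ → ℕ} (hw : ∀ i, 0 < w i)
    (hp : ∀ t : Finset σ, (Ideal.span (u '' t)).IsPrime)
    (hn : ∀ (t : Finset σ) (i : σ), i ∉ t → u i ∉ Ideal.span (u '' t))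
    {F : MvPolynomial σ R} (hF : eval u F = 0)
    {d : σ →₀ ℕ} (ha : ∀ d', Finsupp.weight w d' < Finsupp.weight w d → coeff d' F = 0) :
    coeff d F ∈ Ideal.span (Set.range u) := by
  obtain ⟨G, hFG, hG⟩ := exists_eq_sum_X_sub_C_mul_of_weight hw hp hn hF _ ha
  rw [hFG, coeff_sum]
  refine Ideal.sum_mem _ fun i _ ↦ ?_
  rw [sub_mul, coeff_sub, coeff_C_mul, coeff_X_mul_eq_zero_of_weight hw (hG i) i le_rfl, zero_sub]
  exact neg_mem (Ideal.mul_mem_right _ _ (Ideal.subset_span ⟨i, rfl⟩))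

end MvPolynomial

section ReesAlgebra

open MvPolynomial (weightedHomogeneousComponent)

variable {R σ : Type*} [CommRing R]

/-- The `R`-algebra `R[u_i t^{w_i}]` inside `R[t, t⁻¹]`. -/
noncomputable abbrev reesSubalgebra (u : σ → R) (w : σ → ℕ) : Subalgebra R R[T;T⁻¹] :=
  Algebra.adjoin R (Set.range fun i ↦ C (u i) * T (w i))

/-- The extended algebra `R[t⁻¹, u_i t^{w_i}]` inside `R[t, t⁻¹]`. -/
noncomputable abbrev extendedReesSubalgebra (u : σ → R) (w : σ → ℕ) : Subalgebra R R[T;T⁻¹] :=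
  Algebra.adjoin R (insert (T (-1)) (Set.range fun i ↦ C (u i) * T (w i)))

/-- Polynomials all of whose monomials have weight at least `a`. -/
def MvPolynomial.weightGE (R : Type*) [CommRing R] (w : σ → ℕ) (a : ℤ) :
    Submodule R (MvPolynomial σ R) where
  carrier := {F | ∀ d, (Finsupp.weight w d : ℤ) < a → F.coeff d = 0}
  zero_mem' := by simp
  add_mem' hF hG d hd := by rw [coeff_add, hF d hd, hG d hd, add_zero]
  smul_mem' r F hF d hd := by rw [coeff_smul, hF d hd, smul_zero]

lemma MvPolynomial.mul_mem_weightGE {w : σ → ℕ} {a b : ℤ} {F G : MvPolynomial σ R}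
    (hF : F ∈ weightGE R w a) (hG : G ∈ weightGE R w b) : F * G ∈ weightGE R w (a + b) := by
  classical
  intro d hd
  rw [coeff_mul]
  refine Finset.sum_eq_zero fun x hx ↦ ?_
  rw [← Finset.HasAntidiagonal.mem_antidiagonal.mp hx, map_add, Nat.cast_add] at hd
  rcases lt_or_ge (Finsupp.weight w x.1 : ℤ) a with h | h
  · rw [hF _ h, zero_mul]
  · rw [hG _ (by omega), mul_zero]

/-- The ideal generated by the monomials in the `u i` of weight at least `a`. -/
noncomputable def weightIdeal (u : σ → R) (w : σ → ℕ) (a : ℤ) : Submodule R R :=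
  (MvPolynomial.weightGE R w a).map (MvPolynomial.aeval u).toLinearMap

lemma mem_weightIdeal {u : σ → R} {w : σ → ℕ} {a : ℤ} {x : R} :
    x ∈ weightIdeal u w a ↔
      ∃ G ∈ MvPolynomial.weightGE R w a, MvPolynomial.eval u G = x := by
  simp [weightIdeal, MvPolynomial.aeval_eq_eval]

lemma mul_mem_weightIdeal {u : σ → R} {w : σ → ℕ} {a b : ℤ} {x y : R}
    (hx : x ∈ weightIdeal u w a) (hy : y ∈ weightIdeal u w b) :
    x * y ∈ weightIdeal u w (a + b) := by
  rw [mem_weightIdeal] at *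
  obtain ⟨F, hF, rfl⟩ := hx
  obtain ⟨G, hG, rfl⟩ := hy
  exact ⟨F * G, MvPolynomial.mul_mem_weightGE hF hG, map_mul _ _ _⟩

lemma coeff_mem_weightIdeal_of_mem {u : σ → R} {w : σ → ℕ} {x : R[T;T⁻¹]}
    (hx : x ∈ extendedReesSubalgebra u w) : ∀ a : ℤ, x.coeff a ∈ weightIdeal u w a := by
  classical
  have aux : ∀ (r : R) (n : ℤ), r ∈ weightIdeal u w n →
      ∀ a, (C r * T n : R[T;T⁻¹]).coeff a ∈ weightIdeal u w a := by
    intro r n hr a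
    rw [← single_eq_C_mul_T, AddMonoidAlgebra.coeff_single, Finsupp.single_apply]
    split_ifs with h
    · exact h ▸ hr
    · exact zero_mem _
  have haux : ∀ (r : R) (n : ℤ), n ≤ 0 → r ∈ weightIdeal u w n := fun r n hn ↦
    mem_weightIdeal.mpr ⟨MvPolynomial.C r, fun d hd ↦ by omega, by simp⟩
  induction hx using Algebra.adjoin_induction with
  | mem x hx =>
    obtain rfl | ⟨i, rfl⟩ := hx
    · simpa using aux 1 (-1) (haux _ _ (by simp))
    · refine aux _ _ (mem_weightIdeal.mpr ⟨MvPolynomial.X i, fun d hd ↦ ?_, by simp⟩)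
      rw [MvPolynomial.coeff_X, if_neg]
      rintro rfl
      rw [Finsupp.weight_single, one_smul] at hd
      exact lt_irrefl _ hd
  | algebraMap r =>
    have h := aux r 0 (haux _ _ le_rfl)
    rwa [T_zero, mul_one, C_eq_algebraMap] at h
  | add x y _ _ hx hy =>
    intro a
    rw [AddMonoidAlgebra.coeff_add, Finsupp.add_apply]
    exact add_mem (hx a) (hy a)
  | mul x y _ _ hx hy =>
    intro a
    rw [AddMonoidAlgebra.coeff_mul, Finsupp.sum]
    refine Submodule.sum_mem _ fun i _ ↦ Submodule.sum_mem _ fun j _ ↦ ?_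
    dsimp only
    split_ifs with h
    · exact h ▸ mul_mem_weightIdeal (hx i) (hy j)
    · exact zero_mem _

lemma aeval_C_mul_T_monomial (u : σ → R) (w : σ → ℕ) (d : σ →₀ ℕ) (r : R) :
    MvPolynomial.aeval (fun i ↦ C (u i) * T (w i) : σ → R[T;T⁻¹]) (MvPolynomial.monomial d r) =
      C (MvPolynomial.eval u (MvPolynomial.monomial d r)) * T (Finsupp.weight w d : ℕ) := by
  classical
  have hT : ∀ s : Finset σ, ∏ i ∈ s, (T (w i) : R[T;T⁻¹]) ^ d i =
      T ((∑ i ∈ s, d i • w i : ℕ) : ℤ) := fun s ↦ by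
    induction s using Finset.induction_on with
    | empty => simp
    | insert i s hi ih =>
      rw [Finset.prod_insert hi, Finset.sum_insert hi, ih, T_pow, ← T_add]
      simp
  rw [MvPolynomial.aeval_monomial, MvPolynomial.eval_monomial, Finsupp.weight_apply, Finsupp.sum,
    ← hT, Finsupp.prod, Finsupp.prod, map_mul, map_prod, C_eq_algebraMap, mul_assoc,
    ← Finset.prod_mul_distrib]
  simp only [mul_pow, map_pow, C_eq_algebraMap]

lemma coeff_aeval_C_mul_T (u : σ → R) (w : σ → ℕ) (F : MvPolynomial σ R) (a : ℕ) :
    (MvPolynomial.aeval (fun i ↦ C (u i) * T (w i) : σ → R[T;T⁻¹]) F).coeff (a : ℤ) =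
      MvPolynomial.eval u (weightedHomogeneousComponent w a F) := by
  classical
  induction F using MvPolynomial.induction_on' with
  | monomial d r =>
    rw [aeval_C_mul_T_monomial, ← single_eq_C_mul_T, AddMonoidAlgebra.coeff_single,
      Finsupp.single_apply]
    have h := MvPolynomial.isWeightedHomogeneous_monomial w d r rfl
    split_ifs with hd
    · rw [Nat.cast_inj] at hd
      subst hd
      rw [h.weightedHomogeneousComponent_same]
    · rw [h.weightedHomogeneousComponent_ne _ (fun h ↦ hd (congrArg _ h.symm)), map_zero]
  | add p q hp hq => simp [hp, hq]

/-- The class of `t⁻¹` in the extended Rees algebra. -/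
noncomputable def extendedReesSubalgebra.tInv (u : σ → R) (w : σ → ℕ) :
    extendedReesSubalgebra u w :=
  ⟨T (-1), Algebra.subset_adjoin (Set.mem_insert _ _)⟩

/-- The map `R[X_i] → R[t⁻¹, u_i t^{w_i}]` sending `X_i` to `u_i t^{w_i}`. -/
noncomputable def extendedReesSubalgebra.ofMvPolynomial (u : σ → R) (w : σ → ℕ) :
    MvPolynomial σ R →ₐ[R] extendedReesSubalgebra u w :=
  MvPolynomial.aeval fun i ↦
    ⟨C (u i) * T (w i), Algebra.subset_adjoin (Set.mem_insert_of_mem _ ⟨i, rfl⟩)⟩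

namespace extendedReesSubalgebra

variable {u : σ → R} {w : σ → ℕ}

lemma coe_ofMvPolynomial (F : MvPolynomial σ R) :
    (ofMvPolynomial u w F : R[T;T⁻¹]) = MvPolynomial.aeval (fun i ↦ C (u i) * T (w i)) F := by
  have : (extendedReesSubalgebra u w).val.comp (ofMvPolynomial u w) =
      MvPolynomial.aeval (fun i ↦ C (u i) * T (w i)) := by
    ext i
    simp [ofMvPolynomial]
  exact DFunLike.congr_fun this F

lemma exists_tInv_dvd_sub (x : extendedReesSubalgebra u w) :
    ∃ F, tInv u w ∣ x - ofMvPolynomial u w F := by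
  obtain ⟨x, hx⟩ := x
  induction hx using Algebra.adjoin_induction with
  | mem x hx =>
    obtain rfl | ⟨i, rfl⟩ := hx
    · exact ⟨0, by rw [map_zero, sub_zero]; exact dvd_rfl⟩
    · refine ⟨MvPolynomial.X i, ?_⟩
      rw [ofMvPolynomial, MvPolynomial.aeval_X, sub_self]
      exact dvd_zero _
  | algebraMap r =>
    refine ⟨MvPolynomial.C r, ?_⟩
    rw [ofMvPolynomial, MvPolynomial.aeval_C]
    exact (sub_self (algebraMap R (extendedReesSubalgebra u w) r)).symm ▸ dvd_zero _
  | add x y hx hy ihx ihy =>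
    obtain ⟨F, hF⟩ := ihx
    obtain ⟨G, hG⟩ := ihy
    refine ⟨F + G, ?_⟩
    change tInv u w ∣ (⟨x, hx⟩ + ⟨y, hy⟩ : extendedReesSubalgebra u w) - _
    rw [map_add, add_sub_add_comm]
    exact dvd_add hF hG
  | mul x y hx hy ihx ihy =>
    obtain ⟨F, hF⟩ := ihx
    obtain ⟨G, hG⟩ := ihy
    refine ⟨F * G, ?_⟩
    change tInv u w ∣ (⟨x, hx⟩ * ⟨y, hy⟩ : extendedReesSubalgebra u w) - _
    rw [map_mul]
    exact dvd_mul_sub_mul hF hG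

lemma tInv_dvd_ofMvPolynomial (hw : ∀ i, 0 < w i) {F : MvPolynomial σ R}
    (hF : F ∈ (Ideal.span (Set.range u)).map MvPolynomial.C) :
    tInv u w ∣ ofMvPolynomial u w F := by
  rw [← Ideal.mem_span_singleton]
  suffices h : (Ideal.span (Set.range u)).map (MvPolynomial.C (σ := σ)) ≤
      (Ideal.span {tInv u w}).comap (ofMvPolynomial u w) from h hF
  rw [Ideal.map_span, Ideal.span_le]
  rintro _ ⟨_, ⟨i, rfl⟩, rfl⟩
  rw [SetLike.mem_coe, Ideal.mem_comap, Ideal.mem_span_singleton]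
  refine (dvd_pow_self _ (hw i).ne').trans ⟨ofMvPolynomial u w (MvPolynomial.X i), ?_⟩
  ext1
  rw [coe_ofMvPolynomial, MulMemClass.coe_mul, coe_ofMvPolynomial]
  simp only [MvPolynomial.aeval_C, MvPolynomial.aeval_X, tInv, SubmonoidClass.coe_pow, T_pow]
  rw [mul_left_comm, ← T_add, mul_neg_one, neg_add_cancel, T_zero, mul_one, C_eq_algebraMap]

lemma mem_map_C_of_tInv_dvd [Fintype σ] (hw : ∀ i, 0 < w i)
    (hp : ∀ t : Finset σ, (Ideal.span (u '' t)).IsPrime)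
    (hn : ∀ (t : Finset σ) (i : σ), i ∉ t → u i ∉ Ideal.span (u '' t))
    {F : MvPolynomial σ R} (hF : tInv u w ∣ ofMvPolynomial u w F) :
    F ∈ (Ideal.span (Set.range u)).map MvPolynomial.C := by
  obtain ⟨⟨c, hc⟩, hFc⟩ := hF
  replace hFc := congrArg Subtype.val hFc
  rw [coe_ofMvPolynomial, MulMemClass.coe_mul] at hFc
  refine MvPolynomial.mem_map_C_iff.mpr fun d ↦ ?_
  set a := Finsupp.weight w d with ha
  have h := congrArg (fun x : R[T;T⁻¹] ↦ x.coeff (a : ℤ)) hFc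
  have hcoeff : (T (-1) * c : R[T;T⁻¹]).coeff (a : ℤ) = c.coeff (a + 1 : ℤ) := by
    rw [T, AddMonoidAlgebra.coeff_single_mul_apply, one_mul, neg_neg, add_comm]
  simp only [coeff_aeval_C_mul_T, tInv, hcoeff] at h
  obtain ⟨G, hG, hGc⟩ := mem_weightIdeal.mp (coeff_mem_weightIdeal_of_mem hc (a + 1 : ℤ))
  have hG0 : ∀ d', Finsupp.weight w d' ≤ a → G.coeff d' = 0 := fun d' hd' ↦ hG d' (by omega)
  classical
  have key := MvPolynomial.coeff_mem_span_of_eval_eq_zero hw hp hn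
    (F := weightedHomogeneousComponent w a F - G) (d := d)
    (by rw [map_sub, h, hGc, sub_self]) (fun d' hd' ↦ by
      rw [MvPolynomial.coeff_sub, MvPolynomial.coeff_weightedHomogeneousComponent,
        if_neg hd'.ne, hG0 d' hd'.le, sub_zero])
  rwa [MvPolynomial.coeff_sub, MvPolynomial.coeff_weightedHomogeneousComponent, if_pos rfl,
    hG0 d le_rfl, sub_zero] at key

/-- The quotient of the extended Rees algebra by `t⁻¹` is reduced. -/
theorem tInv_dvd_of_dvd_pow [Fintype σ] (hw : ∀ i, 0 < w i)
    (hp : ∀ t : Finset σ, (Ideal.span (u '' t)).IsPrime)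
    (hn : ∀ (t : Finset σ) (i : σ), i ∉ t → u i ∉ Ideal.span (u '' t))
    {x : extendedReesSubalgebra u w} {m : ℕ} (hx : tInv u w ∣ x ^ m) : tInv u w ∣ x := by
  obtain ⟨F, hF⟩ := exists_tInv_dvd_sub x
  have hFm : tInv u w ∣ ofMvPolynomial u w (F ^ m) := by
    rw [map_pow]
    exact (dvd_sub_right hx).mp (hF.trans (sub_dvd_pow_sub_pow x _ m))
  have hprime : (Ideal.span (Set.range u)).IsPrime := by simpa using hp Finset.univ
  have hFmem := (MvPolynomial.isPrime_map_C hprime).mem_of_pow_mem m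
    (mem_map_C_of_tInv_dvd hw hp hn hFm)
  exact (dvd_iff_dvd_of_dvd_sub hF).mpr (tInv_dvd_ofMvPolynomial hw hFmem)

lemma mem_of_isIntegral_of_T_mul_mem [Fintype σ] (hw : ∀ i, 0 < w i)
    (hp : ∀ t : Finset σ, (Ideal.span (u '' t)).IsPrime)
    (hn : ∀ (t : Finset σ) (i : σ), i ∉ t → u i ∉ Ideal.span (u '' t)) (n : ℕ) {x : R[T;T⁻¹]}
    (hx : IsIntegral (extendedReesSubalgebra u w) x)
    (hn' : T (-n : ℤ) * x ∈ extendedReesSubalgebra u w) : x ∈ extendedReesSubalgebra u w := by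
  induction n with
  | zero => simpa using hn'
  | succ n ih =>
    apply ih
    set y := T (-n : ℤ) * x with hy
    have hT : ∀ k : ℕ, (T (-k : ℤ) : R[T;T⁻¹]) ∈ extendedReesSubalgebra u w := fun k ↦ by
      have h := pow_mem (tInv u w).2 k
      rwa [tInv, T_pow, mul_neg_one] at h
    have hyint : IsIntegral (extendedReesSubalgebra u w) y :=
      (isIntegral_algebraMap (x := (⟨_, hT n⟩ : extendedReesSubalgebra u w))).mul hx
    have hty : T (-1) * y ∈ extendedReesSubalgebra u w := by
      rw [hy, ← mul_assoc, ← T_add]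
      convert hn' using 3
      push_cast
      ring
    obtain ⟨p, hpm, hp0⟩ := hyint
    have hdvd := Polynomial.dvd_pow_natDegree_of_eval₂_eq_zero
      (f := algebraMap (extendedReesSubalgebra u w) R[T;T⁻¹]) Subtype.val_injective hpm
      (tInv u w) ⟨_, hty⟩ y hp0 rfl
    obtain ⟨⟨b, hb⟩, hyb⟩ := tInv_dvd_of_dvd_pow hw hp hn hdvd
    have hyb' : T (-1) * y = T (-1) * b := congrArg Subtype.val hyb
    rwa [(isUnit_T (-1)).mul_left_cancel hyb']

end extendedReesSubalgebra

lemma toLaurent_eq_sum (p : Polynomial R) :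
    Polynomial.toLaurent p = ∑ i ∈ Finset.range (p.natDegree + 1), C (p.coeff i) * T (i : ℤ) := by
  conv_lhs => rw [p.as_sum_range_C_mul_X_pow]
  simp

/-- The extended Rees algebra is integrally closed in `R[t, t⁻¹]` as far as polynomials in `t` are
concerned. -/
theorem toLaurent_mem_extendedReesSubalgebra [Fintype σ] {u : σ → R} {w : σ → ℕ}
    (hw : ∀ i, 0 < w i)
    (hp : ∀ t : Finset σ, (Ideal.span (u '' t)).IsPrime)
    (hn : ∀ (t : Finset σ) (i : σ), i ∉ t → u i ∉ Ideal.span (u '' t)) (p : Polynomial R)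
    (h : IsIntegral (reesSubalgebra u w) (Polynomial.toLaurent p)) :
    Polynomial.toLaurent p ∈ extendedReesSubalgebra u w := by
  have hle : reesSubalgebra u w ≤ extendedReesSubalgebra u w :=
    Algebra.adjoin_mono (Set.subset_insert _ _)
  have hint : IsIntegral (extendedReesSubalgebra u w) (Polynomial.toLaurent p) := by
    obtain ⟨q, hq, hq0⟩ := h
    refine ⟨q.map (Subalgebra.inclusion hle).toRingHom, hq.map _, ?_⟩
    rw [Polynomial.eval₂_map]
    exact hq0
  refine extendedReesSubalgebra.mem_of_isIntegral_of_T_mul_mem hw hp hn p.natDegree hint ?_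
  rw [toLaurent_eq_sum, Finset.mul_sum]
  refine sum_mem fun i hi ↦ ?_
  have hi' : i ≤ p.natDegree := Nat.lt_succ_iff.mp (Finset.mem_range.mp hi)
  have hT : (T (-p.natDegree : ℤ) * (C (p.coeff i) * T (i : ℤ)) : R[T;T⁻¹]) =
      algebraMap R _ (p.coeff i) * T (-1) ^ (p.natDegree - i) := by
    rw [mul_left_comm, ← T_add, T_pow, C_eq_algebraMap]
    congr 2
    push_cast [hi']
    ring
  rw [hT]
  exact mul_mem (Subalgebra.algebraMap_mem _ _)
    (pow_mem (Algebra.subset_adjoin (Set.mem_insert _ _)) _)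

/-- Each `u`-monomial of weight at least `a`, placed in degree `a`, is integral over the Rees
algebra. -/
lemma isIntegral_C_prod_pow_mul_T (u : σ → R) (w : σ → ℕ) (d : σ →₀ ℕ) {a : ℕ}
    (ha : a ≤ Finsupp.weight w d) :
    IsIntegral (reesSubalgebra u w) (C (d.prod fun i n ↦ u i ^ n) * T (a : ℤ) : R[T;T⁻¹]) := by
  classical
  let P : R → ℕ → Prop := fun y n ↦
    ∀ a ≤ n, IsIntegral (reesSubalgebra u w) (C y * T (a : ℤ) : R[T;T⁻¹])
  have hC : ∀ r : R, IsIntegral (reesSubalgebra u w) (C r : R[T;T⁻¹]) := fun r ↦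
    isIntegral_algebraMap (x := algebraMap R (reesSubalgebra u w) r)
  have hone : P 1 0 := fun a ha ↦ by
    obtain rfl := Nat.le_zero.mp ha
    simpa using hC 1
  have hmul : ∀ {y z m n}, P y m → P z n → P (y * z) (m + n) := by
    intro y z m n hy hz a ha
    obtain ⟨b, hb, c, hc, rfl⟩ : ∃ b ≤ m, ∃ c ≤ n, b + c = a :=
      ⟨min a m, min_le_right _ _, a - min a m, by omega, by omega⟩
    have : (C (y * z) * T ((b + c : ℕ) : ℤ) : R[T;T⁻¹]) = (C y * T (b : ℤ)) * (C z * T (c : ℤ)) := by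
      rw [map_mul, Nat.cast_add, T_add]
      ring
    rw [this]
    exact (hy b hb).mul (hz c hc)
  have hu : ∀ i, P (u i) (w i) := fun i a ha ↦ by
    rcases Nat.eq_zero_or_pos (w i) with h0 | hpos
    · obtain rfl : a = 0 := by omega
      simpa using hC (u i)
    refine IsIntegral.of_pow hpos ?_
    have : (C (u i) * T (a : ℤ) : R[T;T⁻¹]) ^ w i =
        C (u i) ^ (w i - a) * (C (u i) * T (w i : ℤ)) ^ a := by
      rw [mul_pow, mul_pow, ← mul_assoc, ← pow_add, Nat.sub_add_cancel ha, T_pow, T_pow, mul_comm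
        (a : ℤ)]
    rw [this]
    refine ((hC _).pow _).mul (.pow ?_ _)
    exact isIntegral_algebraMap
      (x := (⟨_, Algebra.subset_adjoin ⟨i, rfl⟩⟩ : reesSubalgebra u w))
  have hpow : ∀ i n, P (u i ^ n) (n • w i) := fun i n ↦ by
    induction n with
    | zero => simpa using hone
    | succ n ih => simpa only [pow_succ, succ_nsmul] using hmul ih (hu i)
  have hprod : ∀ s : Finset σ, P (∏ i ∈ s, u i ^ d i) (∑ i ∈ s, d i • w i) := fun s ↦ by
    induction s using Finset.induction_on with
    | empty => simpa using hone
    | insert i s hi ih =>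
      rw [Finset.prod_insert hi, Finset.sum_insert hi]
      exact hmul (hpow i _) ih
  exact hprod d.support a ha

theorem isIntegral_toLaurent_of_mem {u : σ → R} {w : σ → ℕ} (p : Polynomial R)
    (h : Polynomial.toLaurent p ∈ extendedReesSubalgebra u w) :
    IsIntegral (reesSubalgebra u w) (Polynomial.toLaurent p) := by
  have hcoeff : ∀ i : ℕ, p.coeff i ∈ weightIdeal u w i := fun i ↦ by
    have := coeff_mem_weightIdeal_of_mem h i
    rw [LaurentPolynomial.coeff_toLaurent] at this
    have hi := Finsupp.mapDomain_apply (Nat.castEmbedding (R := ℤ)).injective p.toFinsupp.coeff i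
    exact (congrArg (· ∈ weightIdeal u w (i : ℤ)) hi).mp this
  rw [toLaurent_eq_sum]
  refine IsIntegral.sum _ fun i _ ↦ ?_
  obtain ⟨G, hG, hGp⟩ := mem_weightIdeal.mp (hcoeff i)
  rw [← hGp, MvPolynomial.eval_eq, map_sum, Finset.sum_mul]
  refine IsIntegral.sum _ fun d hd ↦ ?_
  rw [map_mul, mul_assoc]
  refine IsIntegral.mul ?_ (isIntegral_C_prod_pow_mul_T u w d ?_)
  · exact isIntegral_algebraMap (x := algebraMap R (reesSubalgebra u w) _)
  · by_contra! hlt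
    exact MvPolynomial.mem_support_iff.mp hd (hG d (by exact_mod_cast hlt))

end ReesAlgebra

namespace IsPartialRegSystemOfParams

variable {R : Type*} [CommRing R] [IsLocalRing R] [IsNoetherianRing R] {k : ℕ} {u : Fin k → R}

lemma isPrime_span_image (hu : IsPartialRegSystemOfParams u) (t : Finset (Fin k)) :
    (Ideal.span (u '' t)).IsPrime := by
  obtain ⟨n, v, e, hve, hv, hn⟩ := hu
  obtain rfl : v ∘ e = u := funext hve
  have := IsLocalRing.isPrime_span_image_of_card_le_ringKrullDim (Finset.subset_univ (t.map e)) v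
    (by simpa using hv) (by simp [hn])
  rwa [Finset.coe_map, ← Set.image_comp] at this

lemma notMem_span_image (hu : IsPartialRegSystemOfParams u) (t : Finset (Fin k)) (i : Fin k)
    (hi : i ∉ t) : u i ∉ Ideal.span (u '' t) := by
  obtain ⟨n, v, e, hve, hv, hn⟩ := hu
  obtain rfl : v ∘ e = u := funext hve
  have := IsLocalRing.notMem_span_image_of_card_le_ringKrullDim (Finset.subset_univ (t.map e)) v
    (by simpa using hv) (by simp [hn]) (Finset.mem_univ (e i)) (by simpa using hi)
  rwa [Finset.coe_map, ← Set.image_comp] at this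

end IsPartialRegSystemOfParams

/-- Let `u₁,…,u_k` be part of a regular system of parameters of a regular
(local model of a regular scheme) ring `R`, and `w₁,…,w_k` positive integers.  The integrally
closed Rees algebra `A = R[u₁ t^{w₁},…,u_k t^{w_k}]^{int}` — the elements of `R[t]` integral
over `R[u₁ t^{w₁},…,u_k t^{w_k}]` — coincides with the part of nonnegative `t`-degrees of the
extended Rees algebra `A^{ext} = R[t⁻¹, u₁ t^{w₁},…,u_k t^{w_k}]` (inside the Laurent
polynomial ring `R[t,t⁻¹]`). -/
theorem rees_algebra_eq_nonneg_part_of_extended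
    {R : Type*} [CommRing R] [IsLocalRing R] [IsNoetherianRing R] {k : ℕ}
    (u : Fin k → R) (hu : IsPartialRegSystemOfParams u)
    (w : Fin k → ℕ) (hw : ∀ i, 0 < w i) :
    ∀ x : LaurentPolynomial R,
      (x ∈ Algebra.adjoin R
            (insert (T (-1)) (Set.range fun i => C (u i) * T (w i))) ∧
        x ∈ (Polynomial.toLaurentAlg (R := R)).range) ↔
      (x ∈ (Polynomial.toLaurentAlg (R := R)).range ∧
        IsIntegral ↥(Algebra.adjoin R (Set.range fun i => C (u i) * T (w i))) x) := by
  intro x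
  constructor
  · rintro ⟨hx, p, rfl⟩
    exact ⟨⟨p, rfl⟩, isIntegral_toLaurent_of_mem p hx⟩
  · rintro ⟨⟨p, rfl⟩, hx⟩
    exact ⟨toLaurent_mem_extendedReesSubalgebra hw hu.isPrime_span_image hu.notMem_span_image p hx,
      p, rfl⟩
end

section
/- Let I be an ideal on a regular scheme X and d a natural number. Suppose there exists a weighted center J = (x_1^{1/w_1},...,x_k^{1/w_k}) such that (1) {p ∈ X : ord_p(I) ≥ d} = V(J), and (2) {q ∈ N_J(X) : ord_q(in(I)) ≥ d} = V(J) inside the weighted normal bundle. Then for the cobordant blow-up σ_+: B_+ → X of J, every point q of B_+ satisfies ord_q(σ^s(I)) < d, where σ^s(I) is the strict transform. -/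
open LaurentPolynomial

/-- The coordinate ring `O_B = O_X[t⁻¹, x₁ t^{w₁},…,x_k t^{w_k}]` of the full cobordant
blow-up of the weighted center `J = (x₁^{1/w₁},…,x_k^{1/w_k})`. -/
noncomputable def cobordantAlgebra {R : Type*} [CommRing R] {k : ℕ}
    (x : Fin k → R) (w : Fin k → ℕ) : Subalgebra R (LaurentPolynomial R) :=
  Algebra.adjoin R (insert (T (-1)) (Set.range fun i => C (x i) * T (w i)))

/-- The strict transform `σˢ(I) = {tᵃ·f ∈ O_B : f ∈ O_B·I, a ≥ 0}`. -/
noncomputable def strictTransform {R : Type*} [CommRing R] {k : ℕ}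
    (x : Fin k → R) (w : Fin k → ℕ) (I : Ideal R) : Ideal (cobordantAlgebra x w) :=
  Ideal.span {b : cobordantAlgebra x w | ∃ (a : ℕ) (y : cobordantAlgebra x w),
    y ∈ Ideal.span {z : cobordantAlgebra x w | ∃ g ∈ I, (z : LaurentPolynomial R) = C g} ∧
    (b : LaurentPolynomial R) = T (a : ℤ) * (y : LaurentPolynomial R)}

/-- `ord_P M ≥ d`: the localization of the ideal `M` at the prime `P` lies in the `d`-th
power of the maximal ideal of the local ring at `P`. -/
def OrdGE {A : Type*} [CommRing A] (M : Ideal A) (P : Ideal A) [P.IsPrime] (d : ℕ) : Prop :=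
  Ideal.map (algebraMap A (Localization.AtPrime P)) M ≤
    IsLocalRing.maximalIdeal (Localization.AtPrime P) ^ d

theorem sup_pow_le_sup_pow {A : Type*} [CommRing A] (I J : Ideal A) (n : ℕ) :
    (I ⊔ J) ^ n ≤ I ⊔ J ^ n := by
  induction n with
  | zero => simp
  | succ n ih =>
    calc (I ⊔ J) ^ (n + 1) ≤ (I ⊔ J ^ n) * (I ⊔ J) := by
          rw [pow_succ]
          exact Ideal.mul_mono ih le_rfl
      _ = (I ⊔ J ^ n) * I ⊔ (I * J ⊔ J ^ n * J) := by rw [Ideal.mul_sup, Ideal.sup_mul _ _ J]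
      _ ≤ I ⊔ J ^ (n + 1) := by
          rw [pow_succ]
          exact sup_le (Ideal.mul_le_right.trans le_sup_left)
            (sup_le_sup_right Ideal.mul_le_left _)

/-- Over a local ring, a polynomial prime lying over the maximal ideal does not increase the
order of a constant. -/
theorem mem_maximalIdeal_pow_of_mul_C_mem_pow {L : Type*} [CommRing L] [IsLocalRing L]
    (Q : Ideal (Polynomial L)) [Q.IsPrime]
    (hQ : Q.comap Polynomial.C = IsLocalRing.maximalIdeal L) {d : ℕ} {s : Polynomial L} {f : L}
    (hs : s ∉ Q) (hsf : s * Polynomial.C f ∈ Q ^ d) :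
    f ∈ IsLocalRing.maximalIdeal L ^ d := by
  set m := IsLocalRing.maximalIdeal L with hm
  have hmQ : m.map Polynomial.C ≤ Q := Ideal.map_le_iff_le_comap.2 hQ.ge
  have of_coeff : ∀ r : Polynomial L, r ∉ Q →
      r * Polynomial.C f ∈ (m ^ d).map Polynomial.C → f ∈ m ^ d := by
    intro r hr h
    obtain ⟨n, hn⟩ : ∃ n, r.coeff n ∉ m := by
      by_contra! hcon
      exact hr (hmQ (Ideal.mem_map_C_iff.2 hcon))
    have hu : IsUnit (r.coeff n) := by simpa [hm] using hn
    have := Ideal.mem_map_C_iff.1 h n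
    rw [Polynomial.coeff_mul_C] at this
    exact (Ideal.unit_mul_mem_iff_mem _ hu).1 this
  let π : Polynomial L →+* Polynomial (IsLocalRing.ResidueField L) :=
    Polynomial.mapRingHom (IsLocalRing.residue L)
  have hπ : Function.Surjective π := Polynomial.map_surjective _ IsLocalRing.residue_surjective
  have hker : RingHom.ker π = m.map Polynomial.C := by
    rw [Polynomial.ker_mapRingHom, IsLocalRing.ker_residue]
  obtain ⟨b, hb⟩ := IsPrincipalIdealRing.principal (Q.map π)
  by_cases hb0 : b = 0
  · have hle : Q ≤ m.map Polynomial.C := by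
      intro q hq
      rw [← hker, RingHom.mem_ker]
      have : π q ∈ Q.map π := Ideal.mem_map_of_mem _ hq
      rw [hb, hb0] at this
      simpa using this
    refine of_coeff s hs ?_
    rw [Ideal.map_pow]
    exact Ideal.pow_right_mono hle d hsf
  · obtain ⟨g, hg, -, hgm⟩ : ∃ g : Polynomial L, π g = b * Polynomial.C b.leadingCoeff⁻¹ ∧
        g.natDegree = (b * Polynomial.C b.leadingCoeff⁻¹).natDegree ∧ g.Monic := by
      refine Polynomial.lifts_and_natDegree_eq_and_monic ?_
        (Polynomial.monic_mul_leadingCoeff_inv hb0)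
      obtain ⟨y, hy⟩ := hπ (b * Polynomial.C b.leadingCoeff⁻¹)
      exact ⟨y, hy⟩
    have hQmap : Q.map π = Ideal.span {π g} := by
      rw [hb, hg]
      refine (Ideal.span_singleton_mul_right_unit ?_ b).symm
      exact Polynomial.isUnit_C.2 (by simpa using hb0)
    have hcm : (Q.map π).comap π = Q := by
      rw [Ideal.comap_map_of_surjective' π hπ, hker]
      exact sup_eq_left.2 hmQ
    have hgQ : g ∈ Q := by
      rw [← hcm, Ideal.mem_comap, hQmap]
      exact Ideal.mem_span_singleton_self _
    have hle : Q ≤ Ideal.span {g} ⊔ m.map Polynomial.C := by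
      have : Ideal.span {π g} = (Ideal.span {g}).map π := by
        rw [Ideal.map_span, Set.image_singleton]
      rw [← hcm, hQmap, this, Ideal.comap_map_of_surjective' π hπ, hker]
    have hpow : ∀ n : ℕ, Q ^ n ≤ Ideal.span {g} ⊔ (m ^ n).map Polynomial.C := by
      intro n
      rw [Ideal.map_pow]
      exact (Ideal.pow_right_mono hle n).trans (sup_pow_le_sup_pow _ _ n)
    obtain ⟨y, hy, p, hp, hyp⟩ := Submodule.mem_sup.1 (hpow d hsf)
    have hmod : (s %ₘ g) * Polynomial.C f = p %ₘ g := by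
      have hy0 : y %ₘ g = 0 :=
        (Polynomial.modByMonic_eq_zero_iff_dvd hgm).2 (Ideal.mem_span_singleton.1 hy)
      have : (s * Polynomial.C f) %ₘ g = p %ₘ g := by
        rw [← hyp, Polynomial.add_modByMonic, hy0, zero_add]
      rw [← this, mul_comm s, mul_comm, ← Polynomial.smul_eq_C_mul, ← Polynomial.smul_eq_C_mul,
        Polynomial.smul_modByMonic]
    refine of_coeff (s %ₘ g) ?_ ?_
    · intro h
      refine hs ?_
      rw [← Polynomial.modByMonic_add_div s g]
      exact Q.add_mem h (Q.mul_mem_right _ hgQ)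
    · rw [hmod]
      have hk : (m ^ d).map Polynomial.C =
          RingHom.ker (Polynomial.mapRingHom (Ideal.Quotient.mk (m ^ d))) := by
        rw [Polynomial.ker_mapRingHom, Ideal.mk_ker]
      rw [hk, RingHom.mem_ker] at hp ⊢
      rw [Polynomial.coe_mapRingHom] at hp ⊢
      rw [Polynomial.map_modByMonic _ hgm, hp, Polynomial.zero_modByMonic]

/-- A prime of `R[X]` lying over `P` does not increase the order at `P` of a constant. -/
theorem algebraMap_mem_maximalIdeal_pow_of_mul_C_mem_pow {R : Type*} [CommRing R]
    (P : Ideal R) [P.IsPrime] (Q : Ideal (Polynomial R)) [Q.IsPrime]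
    (hQ : Q.comap Polynomial.C = P) {d : ℕ} {s : Polynomial R} {f : R}
    (hs : s ∉ Q) (hsf : s * Polynomial.C f ∈ Q ^ d) :
    algebraMap R (Localization.AtPrime P) f ∈
      IsLocalRing.maximalIdeal (Localization.AtPrime P) ^ d := by
  let L := Localization.AtPrime P
  let φ : Polynomial R →+* Polynomial L := Polynomial.mapRingHom (algebraMap R L)
  let _ : Algebra (Polynomial R) (Polynomial L) := φ.toAlgebra
  have hloc : IsLocalization (P.primeCompl.map (Polynomial.C : R →+* Polynomial R))
      (Polynomial L) := Polynomial.isLocalization P.primeCompl L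
  have hdisj : Disjoint ((P.primeCompl.map (Polynomial.C : R →+* Polynomial R) :
      Submonoid (Polynomial R)) : Set (Polynomial R)) (Q : Set (Polynomial R)) := by
    rw [Set.disjoint_left]
    rintro _ ⟨r, hr, rfl⟩ h
    exact hr (hQ ▸ h)
  have hprime : (Q.map φ).IsPrime :=
    IsLocalization.isPrime_of_isPrime_disjoint _ (Polynomial L) Q ‹_› hdisj
  have hcm : (Q.map φ).comap φ = Q :=
    IsLocalization.under_map_of_isPrime_disjoint _ (Polynomial L) ‹_› hdisj
  refine mem_maximalIdeal_pow_of_mul_C_mem_pow (Q.map φ) (s := φ s) ?_ ?_ ?_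
  · refine le_antisymm (IsLocalRing.le_maximalIdeal (Ideal.IsPrime.ne_top inferInstance)) ?_
    rw [← Localization.AtPrime.map_eq_maximalIdeal, Ideal.map_le_iff_le_comap]
    intro r hr
    have : Polynomial.C r ∈ Q := by rwa [← hQ] at hr
    have := Ideal.mem_map_of_mem φ this
    simpa [φ] using this
  · intro h
    rw [← Ideal.mem_comap, hcm] at h
    exact hs h
  · have := Ideal.mem_map_of_mem φ hsf
    rw [Ideal.map_pow] at this
    simpa [φ] using this

/-- If `A` lies between `R[t⁻¹]` and `R[t, t⁻¹]`, then the order of an element of `R` does not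
increase at the primes of `A` which do not contain `t⁻¹`. -/
theorem algebraMap_mem_maximalIdeal_pow_of_subalgebra {R : Type*} [CommRing R]
    (A : Subalgebra R (LaurentPolynomial R)) (τ : A)
    (hτ : (τ : LaurentPolynomial R) = T (-1)) (Q : Ideal A) [Q.IsPrime] (hτQ : τ ∉ Q)
    (P : Ideal R) [P.IsPrime] (hP : Q.comap (algebraMap R A) = P) {d : ℕ} {f : R}
    (hf : algebraMap A (Localization.AtPrime Q) (algebraMap R A f) ∈
      IsLocalRing.maximalIdeal (Localization.AtPrime Q) ^ d) :
    algebraMap R (Localization.AtPrime P) f ∈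
      IsLocalRing.maximalIdeal (Localization.AtPrime P) ^ d := by
  let j : Polynomial R →ₐ[R] A := Polynomial.aeval τ
  have hj : ∀ p, invert (j p : LaurentPolynomial R) = Polynomial.toLaurent p := by
    have : ((invert (R := R)).toAlgHom.comp (A.val.comp j)) =
        (Polynomial.toLaurentAlg : Polynomial R →ₐ[R] LaurentPolynomial R) := by
      refine Polynomial.algHom_ext ?_
      simp [j, hτ]
    exact fun p => DFunLike.congr_fun this p
  have hinj : Function.Injective j := by
    intro p q h
    exact Polynomial.toLaurent_injective (by rw [← hj, ← hj, h])
  have hex : ∀ a : A, ∃ (n : ℕ) (p : Polynomial R), j p = τ ^ n * a := by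
    intro a
    obtain ⟨n, p, hp⟩ := exists_T_pow (invert (a : LaurentPolynomial R))
    refine ⟨n, p, Subtype.ext (invert.injective ?_)⟩
    rw [hj, hp]
    change _ = invert ((τ : LaurentPolynomial R) ^ n * (a : LaurentPolynomial R))
    rw [map_mul, map_pow, hτ, invert_T, neg_neg, T_pow, mul_one, mul_comm]
  have hjX : j Polynomial.X = τ := by simp [j]
  have hpowQ : ∀ n : ℕ, τ ^ n ∉ Q := fun n h => hτQ (Ideal.IsPrime.mem_of_pow_mem ‹_› n h)
  have hpow : ∀ n : ℕ, ∀ z ∈ Q ^ n, ∃ (N : ℕ), ∃ p ∈ (Q.comap j) ^ n, j p = τ ^ N * z := by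
    intro n
    induction n with
    | zero =>
      intro z _
      obtain ⟨N, p, hp⟩ := hex z
      exact ⟨N, p, by simp, hp⟩
    | succ n ih =>
      intro z hz
      rw [pow_succ] at hz
      refine Submodule.mul_induction_on hz ?_ ?_
      · intro a ha b hb
        obtain ⟨N, p, hp, hpa⟩ := ih a ha
        obtain ⟨M, q, hqb⟩ := hex b
        refine ⟨N + M, p * q, ?_, ?_⟩
        · rw [pow_succ]
          refine Ideal.mul_mem_mul hp ?_
          rw [Ideal.mem_comap, hqb]
          exact Q.mul_mem_left _ hb
        · rw [map_mul, hpa, hqb]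
          ring
      · rintro a b ⟨N, p, hp, hpa⟩ ⟨M, q, hq, hqb⟩
        refine ⟨N + M, Polynomial.X ^ M * p + Polynomial.X ^ N * q,
          Ideal.add_mem _ (Ideal.mul_mem_left _ _ hp) (Ideal.mul_mem_left _ _ hq), ?_⟩
        rw [map_add, map_mul, map_mul, map_pow, map_pow, hjX, hpa, hqb]
        ring
  rw [← Localization.AtPrime.map_eq_maximalIdeal, ← Ideal.map_pow,
    IsLocalization.algebraMap_mem_map_algebraMap_iff Q.primeCompl] at hf
  obtain ⟨s, hs, hsf⟩ := hf
  obtain ⟨N, p, hp, hpz⟩ := hpow d _ hsf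
  obtain ⟨M, s', hs'⟩ := hex s
  refine algebraMap_mem_maximalIdeal_pow_of_mul_C_mem_pow P (Q.comap j)
    (s := Polynomial.X ^ N * s') ?_ ?_ ?_
  · rw [← hP]
    ext r
    simp [Ideal.mem_comap, j]
  · rw [Ideal.mem_comap, map_mul, map_pow, hjX, hs', ← mul_assoc, ← pow_add]
    intro h
    exact (Ideal.IsPrime.mem_or_mem ‹_› h).elim (hpowQ _) hs
  · have : Polynomial.X ^ N * s' * Polynomial.C f = Polynomial.X ^ M * p := by
      apply hinj
      have hC : j (Polynomial.C f) = algebraMap R A f := by simp [j]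
      rw [map_mul, map_mul, map_mul, map_pow, map_pow, hjX, hs', hpz, hC]
      ring
    rw [this]
    exact Ideal.mul_mem_left _ _ hp

/-- The order of an ideal does not decrease under pullback along a ring homomorphism. -/
theorem OrdGE.map {A B : Type*} [CommRing A] [CommRing B] (φ : A →+* B) {M : Ideal A}
    (P : Ideal A) [P.IsPrime] (Q : Ideal B) [Q.IsPrime] (hPQ : P = Q.comap φ) {d : ℕ}
    (h : OrdGE M P d) : OrdGE (M.map φ) Q d := by
  unfold OrdGE at h ⊢
  have hcomp : (algebraMap B (Localization.AtPrime Q)).comp φ =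
      (Localization.localRingHom P Q φ hPQ).comp (algebraMap A (Localization.AtPrime P)) :=
    RingHom.ext fun a => (Localization.localRingHom_to_map P Q φ hPQ a).symm
  rw [Ideal.map_map, hcomp, ← Ideal.map_map]
  refine (Ideal.map_mono h).trans ?_
  rw [Ideal.map_pow]
  refine Ideal.pow_right_mono ?_ d
  exact ((IsLocalRing.local_hom_TFAE (Localization.localRingHom P Q φ hPQ)).out 0 2).1
    (Localization.isLocalHom_localRingHom P Q φ hPQ)

set_option synthInstance.maxHeartbeats 1000000 in
/-- Let `I` be an ideal on a regular (local model of a) scheme `X` and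
`d ∈ ℕ`.  Suppose there is a weighted center `J = (x₁^{1/w₁},…,x_k^{1/w_k})` such that
(1) the locus `{p ∈ X : ord_p I ≥ d}` is exactly `V(J) = V(x₁,…,x_k)`, and
(2) inside the weighted normal bundle `N_J(X) = V_B(t⁻¹)` — whose coordinate ring is
`O_B/(t⁻¹)`, the ideal of initial forms `in(I)` being the image of the strict transform —
the locus `{q : ord_q (in I) ≥ d}` is exactly the vertex `V(J)`.  Then on the cobordant
blow-up `B₊ = B \ V(x'₁,…,x'_k)` every point `q` satisfies `ord_q (σˢ I) < d`. -/
theorem order_drops_on_cobordant_blowup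
    {R : Type*} [CommRing R] [IsLocalRing R] [IsNoetherianRing R] {k : ℕ}
    (x : Fin k → R) (hx : IsPartialRegSystemOfParams x)
    (w : Fin k → ℕ) (hw : ∀ i, 0 < w i)
    (I : Ideal R) (d : ℕ)
    (E : Fin k → cobordantAlgebra x w)
    (hE : ∀ j, (E j : LaurentPolynomial R) = C (x j) * T (w j))
    (τ : cobordantAlgebra x w) (hτ : (τ : LaurentPolynomial R) = T (-1))
    (h1 : ∀ (P : Ideal R) [P.IsPrime], OrdGE I P d ↔ ∀ i, x i ∈ P)
    (h2 : ∀ (Q : Ideal (cobordantAlgebra x w ⧸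
          (Ideal.span {τ} : Ideal (cobordantAlgebra x w)))) [Q.IsPrime],
        OrdGE (Ideal.map (Ideal.Quotient.mk (Ideal.span {τ})) (strictTransform x w I)) Q d ↔
          ∀ i, Ideal.Quotient.mk (Ideal.span {τ}) (E i) ∈ Q) :
    ∀ (Q : Ideal (cobordantAlgebra x w)) [Q.IsPrime],
      (¬ ∀ i, E i ∈ Q) → ¬ OrdGE (strictTransform x w I) Q d := by
  intro Q _ hE_not hQ
  by_cases hτQ : τ ∈ Q
  · have hle : Ideal.span {τ} ≤ Q := (Ideal.span_singleton_le_iff_mem Q).2 hτQ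
    have hsurj := Ideal.Quotient.mk_surjective (I := Ideal.span {τ})
    have hker : RingHom.ker (Ideal.Quotient.mk (Ideal.span {τ})) ≤ Q := by
      rwa [Ideal.mk_ker]
    have hprime : (Q.map (Ideal.Quotient.mk (Ideal.span {τ}))).IsPrime :=
      Ideal.map_isPrime_of_surjective hsurj hker
    have hcomap : Q = (Q.map (Ideal.Quotient.mk (Ideal.span {τ}))).comap
        (Ideal.Quotient.mk (Ideal.span {τ})) := by
      rw [Ideal.comap_map_of_surjective' _ hsurj]
      exact (sup_eq_left.2 hker).symm
    refine hE_not fun i => ?_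
    rw [hcomap]
    exact (h2 _).1 (hQ.map _ Q _ hcomap) i
  · have hxE : ∀ i, algebraMap R (cobordantAlgebra x w) (x i) = τ ^ w i * E i := by
      intro i
      refine Subtype.ext ?_
      change algebraMap R (LaurentPolynomial R) (x i) =
        (τ : LaurentPolynomial R) ^ w i * (E i : LaurentPolynomial R)
      rw [hτ, hE, T_pow, mul_left_comm, ← T_add]
      simp [LaurentPolynomial.algebraMap_apply]
    refine hE_not fun i => ?_
    have hI : OrdGE I (Q.comap (algebraMap R (cobordantAlgebra x w))) d := by
      refine Ideal.map_le_iff_le_comap.2 fun f hf => ?_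
      refine algebraMap_mem_maximalIdeal_pow_of_subalgebra _ τ hτ Q hτQ _ rfl ?_
      refine hQ (Ideal.mem_map_of_mem _ (Ideal.subset_span ?_))
      exact ⟨0, algebraMap R (cobordantAlgebra x w) f,
        Ideal.subset_span ⟨f, hf, rfl⟩, by simp⟩
    have hxQ := (h1 _).1 hI i
    rw [Ideal.mem_comap, hxE] at hxQ
    exact (Ideal.IsPrime.mem_or_mem ‹_› hxQ).resolve_left
      fun h => hτQ (Ideal.IsPrime.mem_of_pow_mem ‹_› _ h)
end
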